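/- arXiv:1201.4439 — 3 statements merged into one kernel-verified Lean document; each statement's English description precedes it below -/
import Mathlib

section
/- Every relation R on ℚ that is definable in ⟨ℚ,<⟩ satisfies exactly one of: R ≈ <, or R ≈ b, or R ≈ c, or R ≈ s, or R is definable without parameters by a first-order formula in the pure language of equality (i.e. R is preserved by every permutation of ℚ). -/
open FirstOrder Language

/-- Language with relation symbols indexed by `ι`, where symbol `i` has arity `ar i`. -/
def multiRelLang {ι : Type} (ar : ι → ℕ) : FirstOrder.Language where
  Functions _ := Empty
  Relations m := { i : ι // ar i = m }

/-- The structure on `M` interpreting symbol `i` as the relation `Rels i`. -/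
def multiRelStructure {M : Type*} {ι : Type} {ar : ι → ℕ}
    (Rels : ∀ i, (Fin (ar i) → M) → Prop) : (multiRelLang ar).Structure M where
  funMap f := f.elim
  RelMap r x := Rels r.1 fun j => x (Fin.cast r.2 j)

/-- Language with one relation symbol, of arity `n`. -/
def relLang (n : ℕ) : FirstOrder.Language := multiRelLang (fun _ : Unit => n)

/-- `R` is definable, without parameters, by a first-order formula in the language with a
single relation symbol interpreted as `Q`. -/
def DefinableBy {M : Type*} {n k : ℕ} (Q : (Fin n → M) → Prop)
    (R : (Fin k → M) → Prop) : Prop :=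
  letI : (relLang n).Structure M := multiRelStructure (fun _ : Unit => Q)
  ∃ φ : (relLang n).Formula (Fin k), ∀ v : Fin k → M, R v ↔ φ.Realize v

/-- The order relation on `ℚ`, as a binary relation on tuples. -/
def ltRel : (Fin 2 → ℚ) → Prop := fun v => v 0 < v 1

/-- The betweenness relation `b` on `ℚ`. -/
def bRel : (Fin 3 → ℚ) → Prop := fun v =>
  (v 0 < v 1 ∧ v 1 < v 2) ∨ (v 2 < v 1 ∧ v 1 < v 0)

/-- The cyclic order relation `c` on `ℚ`. -/
def cRel : (Fin 3 → ℚ) → Prop := fun v =>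
  (v 0 < v 1 ∧ v 1 < v 2) ∨ (v 1 < v 2 ∧ v 2 < v 0) ∨ (v 2 < v 0 ∧ v 0 < v 1)

/-- The separation relation `s` on `ℚ`. -/
def sRel : (Fin 4 → ℚ) → Prop := fun v =>
  (cRel ![v 0, v 1, v 2] ∧ cRel ![v 2, v 3, v 0]) ∨
  (cRel ![v 2, v 1, v 0] ∧ cRel ![v 0, v 3, v 2])

/-- `R` is definable, without parameters, by a first-order formula in the pure language of
equality (the empty language). -/
def EqDefinable {M : Type*} {k : ℕ} (R : (Fin k → M) → Prop) : Prop :=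
  letI : Language.empty.Structure M := Language.emptyStructure
  ∃ φ : Language.empty.Formula (Fin k), ∀ v : Fin k → M, R v ↔ φ.Realize v

/-- `Q ≈ R` : the relations `Q` and `R` define each other. -/
def DefEquiv {M : Type*} {n k : ℕ} (Q : (Fin n → M) → Prop)
    (R : (Fin k → M) → Prop) : Prop :=
  DefinableBy Q R ∧ DefinableBy R Q

/-- `ℚ` is homogeneous: a finite order-preserving correspondence extends to an automorphism. -/
theorem exists_orderIso_of_lt_iff {ι : Type*} (F : Finset ι) (u v : ι → ℚ)
    (h : ∀ i ∈ F, ∀ j ∈ F, (u i < u j ↔ v i < v j)) :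
    ∃ e : ℚ ≃o ℚ, ∀ i ∈ F, e (u i) = v i := by
  classical
  let p : Order.PartialIso ℚ ℚ := ⟨F.image fun i => (u i, v i), by
    simp only [Finset.mem_image]
    rintro _ ⟨i, hi, rfl⟩ _ ⟨j, hj, rfl⟩
    have h1 := h i hi j hj
    have h2 := h j hj i hi
    rcases lt_trichotomy (u i) (u j) with hlt | heq | hgt
    · rw [cmp_eq_lt_iff _ _ |>.2 hlt, cmp_eq_lt_iff _ _ |>.2 (h1.1 hlt)]
    · have : v i = v j := le_antisymm (not_lt.1 fun hh => (h2.2 hh).ne heq.symm)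
        (not_lt.1 fun hh => (h1.2 hh).ne heq)
      rw [cmp_eq_eq_iff _ _ |>.2 heq, cmp_eq_eq_iff _ _ |>.2 this]
    · rw [cmp_eq_gt_iff _ _ |>.2 hgt, cmp_eq_gt_iff _ _ |>.2 (h2.1 hgt)]⟩
  let cof : ℚ ⊕ ℚ → Order.Cofinal (Order.PartialIso ℚ ℚ) := fun x =>
    Sum.recOn x (Order.PartialIso.definedAtLeft ℚ) (Order.PartialIso.definedAtRight ℚ)
  let I := Order.idealOfCofinals p cof
  let f a := Order.PartialIso.funOfIdeal a I
    (Order.cofinal_meets_idealOfCofinals _ cof (Sum.inl a))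
  let g b := Order.PartialIso.invOfIdeal b I
    (Order.cofinal_meets_idealOfCofinals _ cof (Sum.inr b))
  refine ⟨OrderIso.ofCmpEqCmp (fun a => (f a).val) (fun b => (g b).val) fun a b => ?_,
    fun i hi => ?_⟩
  · rcases (f a).prop with ⟨s, hs, ha⟩
    rcases (g b).prop with ⟨t, ht, hb⟩
    rcases I.directed _ hs _ ht with ⟨m, _, fm, gm⟩
    exact m.prop (a, _) (fm ha) (_, b) (gm hb)
  · change (f (u i)).val = v i
    rcases (f (u i)).prop with ⟨s, hs, ha⟩
    rcases I.directed _ hs _ (Order.mem_idealOfCofinals p cof) with ⟨m, _, fm, gm⟩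
    have h0 : (u i, v i) ∈ p.val := Finset.mem_image_of_mem (fun i => (u i, v i)) hi
    have := m.prop (u i, _) (fm ha) (u i, v i) (gm h0)
    rw [cmp_self_eq_eq] at this
    exact (cmp_eq_eq_iff _ _).1 this.symm

theorem exists_orderIso_of_strictMonoOn {F : Finset ℚ} {f : ℚ → ℚ}
    (hf : StrictMonoOn f (F : Set ℚ)) : ∃ e : ℚ ≃o ℚ, ∀ x ∈ F, e x = f x :=
  exists_orderIso_of_lt_iff F id f fun _ hi _ hj => (hf.lt_iff_lt hi hj).symm

/-- Finitely many points `L < x < y < R` can be fixed outside `x, y` while moving `x, y` to any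
other pair in the same position. -/
theorem exists_orderIso_move_pair {L R : Finset ℚ} {x y x' y' : ℚ}
    (hL : ∀ a ∈ L, a < x) (hR : ∀ b ∈ R, y < b) (hxy : x < y)
    (hL' : ∀ a ∈ L, a < x') (hR' : ∀ b ∈ R, y' < b) (hxy' : x' < y') :
    ∃ e : ℚ ≃o ℚ, (∀ a ∈ L, e a = a) ∧ (∀ b ∈ R, e b = b) ∧ e x = x' ∧ e y = y' := by
  classical
  let f : ℚ → ℚ := fun z => if z = x then x' else if z = y then y' else z
  have fx : f x = x' := if_pos rfl
  have fy : f y = y' := (if_neg hxy.ne').trans (if_pos rfl)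
  have fL : ∀ a ∈ L, f a = a := fun a ha =>
    (if_neg (hL a ha).ne).trans (if_neg ((hL a ha).trans hxy).ne)
  have fR : ∀ b ∈ R, f b = b := fun b hb =>
    (if_neg (hxy.trans (hR b hb)).ne').trans (if_neg (hR b hb).ne')
  obtain ⟨e, he⟩ := exists_orderIso_of_strictMonoOn (F := insert x (insert y (L ∪ R)))
    (f := f) (by
      intro a ha b hb hab
      simp only [Finset.coe_insert, Finset.coe_union, Set.mem_insert_iff, Set.mem_union,
        Finset.mem_coe] at ha hb
      rcases ha with rfl | rfl | ha | ha <;> rcases hb with rfl | rfl | hb | hb <;>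
        simp only [fL _, fR _, *] <;>
        first
        | linarith
        | linarith [hL _ ‹_›, hL' _ ‹_›]
        | linarith [hR _ ‹_›, hR' _ ‹_›])
  exact ⟨e, fun a ha => (he a (by simp [ha])).trans (fL a ha),
    fun b hb => (he b (by simp [hb])).trans (fR b hb), (he x (by simp)).trans fx,
    (he y (by simp)).trans fy⟩

theorem exists_orderIso_move {L R : Finset ℚ} {x x' : ℚ}
    (hL : ∀ a ∈ L, a < x) (hR : ∀ b ∈ R, x < b)
    (hL' : ∀ a ∈ L, a < x') (hR' : ∀ b ∈ R, x' < b) :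
    ∃ e : ℚ ≃o ℚ, (∀ a ∈ L, e a = a) ∧ (∀ b ∈ R, e b = b) ∧ e x = x' := by
  classical
  obtain ⟨y, hy, hyR⟩ := Order.exists_between_finsets {x, x'} R (by
    simp only [Finset.mem_insert, Finset.mem_singleton]
    rintro a (rfl | rfl) b hb
    exacts [hR b hb, hR' b hb])
  obtain ⟨e, h1, h2, h3, -⟩ := exists_orderIso_move_pair hL hyR (hy x (by simp)) hL' hyR
    (hy x' (by simp))
  exact ⟨e, h1, h2, h3⟩

/-- `G` contains every automorphism of `⟨ℚ, <⟩`. -/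
def ContainsOrderAut (G : Subgroup (Equiv.Perm ℚ)) : Prop :=
  ∀ e : ℚ ≃o ℚ, e.toEquiv ∈ G

/-- Every finite partial injection is the restriction of an element of `G`. -/
def HighlyTransitive (G : Subgroup (Equiv.Perm ℚ)) : Prop :=
  ∀ (F : Finset ℚ) (f : ℚ → ℚ), Set.InjOn f F → ∃ g ∈ G, ∀ x ∈ F, g x = f x

/-- Two points can be swapped while fixing at most `l` points to their left and at most `r` points
to their right. -/
def SwapsAdjacent (G : Subgroup (Equiv.Perm ℚ)) (l r : ℕ) : Prop :=
  ∀ (L R : Finset ℚ) (x y : ℚ), (∀ a ∈ L, a < x) → x < y → (∀ b ∈ R, y < b) →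
    L.card ≤ l → R.card ≤ r →
    ∃ g ∈ G, (∀ a ∈ L, g a = a) ∧ (∀ b ∈ R, g b = b) ∧ g x = y ∧ g y = x

/-- A point can be moved from the left to the right of any `k` points, all of these and one more
point on the left being fixed. -/
def Rotates (G : Subgroup (Equiv.Perm ℚ)) (k : ℕ) : Prop :=
  ∀ (K : Finset ℚ) (c x y : ℚ), c < x → (∀ a ∈ K, x < a) → (∀ a ∈ K, a < y) → x < y →
    K.card ≤ k → ∃ g ∈ G, g c = c ∧ (∀ a ∈ K, g a = a) ∧ g x = y

theorem exists_mem_above {G : Subgroup (Equiv.Perm ℚ)} (hG : ContainsOrderAut G) {r : ℕ}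
    (hr : ∀ l, SwapsAdjacent G l r) (L D : Finset ℚ) (hLD : ∀ a ∈ L, ∀ d ∈ D, a < d)
    (hD : D.card ≤ r + 1) :
    ∀ (n : ℕ) (w : ℚ), (∀ a ∈ L, a < w) → w ∉ D → (D.filter (w < ·)).card = n →
      ∃ g ∈ G, (∀ a ∈ L, g a = a) ∧ (∀ d ∈ D, g d = d) ∧ ∀ d ∈ D, d < g w := by
  intro n
  induction n with
  | zero =>
    intro w hLw hw hn
    refine ⟨1, G.one_mem, by simp, by simp, fun d hd => ?_⟩
    rw [Finset.card_eq_zero, Finset.filter_eq_empty_iff] at hn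
    exact lt_of_le_of_ne (not_lt.1 (hn hd)) fun h => hw ((show d = w from h) ▸ hd)
  | succ n ih =>
    intro w hLw hw hn
    have hne : (D.filter (w < ·)).Nonempty := Finset.card_pos.1 (by omega)
    obtain ⟨d, hdm, hmin⟩ := (D.filter (w < ·)).exists_min_image id hne
    obtain ⟨hdD, hwd⟩ := Finset.mem_filter.1 hdm
    set L' := L ∪ D.filter (· < w) with hL'
    set R := D.filter (d < ·) with hR
    have hRc : R.card ≤ r := by
      have : R ⊂ D := (Finset.ssubset_iff_of_subset (Finset.filter_subset _ _)).2
        ⟨d, hdD, by simp⟩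
      have := Finset.card_lt_card this
      omega
    have hL'w : ∀ a ∈ L', a < w := by
      intro a ha
      rcases Finset.mem_union.1 ha with ha | ha
      · exact hLw a ha
      · exact (Finset.mem_filter.1 ha).2
    have hRd : ∀ b ∈ R, d < b := fun b hb => (Finset.mem_filter.1 hb).2
    have hcase : ∀ z ∈ D, z ∈ L' ∨ z = d ∨ z ∈ R := by
      intro z hz
      rcases lt_trichotomy z w with h | h | h
      · exact Or.inl (Finset.mem_union_right _ (Finset.mem_filter.2 ⟨hz, h⟩))
      · exact absurd (h ▸ hz) hw
      · rcases (hmin z (Finset.mem_filter.2 ⟨hz, h⟩)).lt_or_eq with h' | h'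
        · exact Or.inr (Or.inr (Finset.mem_filter.2 ⟨hz, h'⟩))
        · exact Or.inr (Or.inl h'.symm)
    obtain ⟨f, hfG, hfL, hfR, hfw, hfd⟩ := hr _ L' R w d hL'w hwd hRd le_rfl hRc
    obtain ⟨v, hv, hvR⟩ := Order.exists_between_finsets {d} R (by simpa using hRd)
    have hdv : d < v := hv d (by simp)
    obtain ⟨e, heL, heR, hew, hed⟩ := exists_orderIso_move_pair hL'w hRd hwd
      (x' := d) (y' := v) (fun a ha => (hL'w a ha).trans hwd) hvR hdv
    have hvD : v ∉ D := by
      intro hvD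
      rcases hcase v hvD with h | h | h
      · exact absurd (hL'w v h) (not_lt.2 (hwd.trans hdv).le)
      · exact hdv.ne' h
      · exact lt_irrefl v (hvR v h)
    obtain ⟨g, hgG, hgL, hgD, hgv⟩ := ih v (fun a ha => (hLD a ha d hdD).trans hdv) hvD (by
      have h1 : D.filter (v < ·) = R := by
        ext z
        simp only [Finset.mem_filter, hR]
        refine ⟨fun h => ⟨h.1, hdv.trans h.2⟩, fun h => ⟨h.1, hvR z ?_⟩⟩
        exact Finset.mem_filter.2 h
      have h2 : D.filter (w < ·) = insert d R := by
        ext z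
        simp only [Finset.mem_filter, hR, Finset.mem_insert]
        refine ⟨fun h => ?_, ?_⟩
        · rcases hcase z h.1 with h' | h' | h'
          · exact absurd (hL'w z h') (not_lt.2 h.2.le)
          · exact Or.inl h'
          · exact Or.inr (Finset.mem_filter.1 h')
        · rintro (rfl | h)
          · exact ⟨hdD, hwd⟩
          · exact ⟨h.1, hwd.trans h.2⟩
      rw [h2, Finset.card_insert_of_notMem (by simp [hR])] at hn
      rw [h1]
      omega)
    refine ⟨g * (e.toEquiv * f), G.mul_mem hgG (G.mul_mem (hG e) hfG), fun a ha => ?_,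
      fun z hz => ?_, ?_⟩
    · have := Finset.mem_union_left (D.filter (· < w)) ha
      simp [hfL a this, heL a this, hgL a ha]
    · rcases hcase z hz with h | rfl | h
      · simp [hfL z h, heL z h, hgD z hz]
      · simp [hfd, hew, hgD z hz]
      · simp [hfR z h, heR z h, hgD z hz]
    · simpa [hfw, hed] using hgv

theorem swapsAdjacent_of_left {G : Subgroup (Equiv.Perm ℚ)} (hG : ContainsOrderAut G)
    (h0 : ∀ l, SwapsAdjacent G l 0) : ∀ r l, SwapsAdjacent G l r := by
  intro r
  induction r with
  | zero => exact h0
  | succ r ih =>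
    intro l L R x y hL hxy hR _ hRc
    by_cases hRr : R.card ≤ r
    · exact ih _ L R x y hL hxy hR le_rfl hRr
    obtain ⟨z, hzR, hmax⟩ := R.exists_max_image id (Finset.card_pos.1 (by omega))
    have hRc' : (R.erase z).card ≤ r := by rw [Finset.card_erase_of_mem hzR]; omega
    have hR' : ∀ b ∈ R.erase z, y < b := fun b hb => hR b (Finset.mem_of_mem_erase hb)
    have hyz := hR z hzR
    have hR'z : ∀ b ∈ R.erase z, b < z := fun b hb =>
      lt_of_le_of_ne (hmax b (Finset.mem_of_mem_erase hb)) (Finset.ne_of_mem_erase hb)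
    obtain ⟨g, hgG, hgL, hgR, hgx, hgy⟩ := ih _ L (R.erase z) x y hL hxy hR' le_rfl hRc'
    have hRz : ∀ b ∈ R, b ∈ R.erase z ∨ b = z := fun b hb => by
      by_cases h : b = z
      · exact Or.inr h
      · exact Or.inl (Finset.mem_erase.2 ⟨h, hb⟩)
    have hne : ∀ a, a ≠ z → g z ≠ g a := fun a ha h => ha (g.injective h).symm
    rcases lt_trichotomy (g z) x with hlt | heq | hgt
    · obtain ⟨f, hfG, hfL, hfR, hfx, hfy⟩ := ih _ (insert (g z) L) (R.erase z) x y
        (by simpa using ⟨hlt, hL⟩) hxy hR' le_rfl hRc'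
      refine ⟨g⁻¹ * (f * g), G.mul_mem (G.inv_mem hgG) (G.mul_mem hfG hgG), fun a ha => ?_,
        fun b hb => ?_, ?_, ?_⟩
      · have := hfL a (Finset.mem_insert_of_mem ha)
        simp [Equiv.symm_apply_eq, hgL a ha, this]
      · rcases hRz b hb with h | rfl
        · simp [Equiv.symm_apply_eq, hgR b h, hfR b h]
        · simp [hfL (g b) (by simp)]
      · simp [Equiv.symm_apply_eq, hgx, hgy, hfy]
      · simp [Equiv.symm_apply_eq, hgx, hgy, hfx]
    · exact absurd (heq.trans hgy.symm) (hne y hyz.ne)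
    · have hyR : y ∉ R.erase z := fun h => lt_irrefl y (hR' y h)
      have hxz : x ≠ z := (hxy.trans hyz).ne
      obtain ⟨k, hkG, hkL, hkD, hkw⟩ := exists_mem_above hG ih (insert x L)
        (insert y (R.erase z))
        (by
          intro a ha d hd
          have h1 : a ≤ x := by
            rcases Finset.mem_insert.1 ha with rfl | h
            · exact le_rfl
            · exact (hL a h).le
          have h2 : y ≤ d := by
            rcases Finset.mem_insert.1 hd with rfl | h
            · exact le_rfl
            · exact (hR' d h).le
          exact h1.trans_lt (hxy.trans_le h2))
        (by rw [Finset.card_insert_of_notMem hyR]; omega)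
        _ (g z)
        (by
          simp only [Finset.mem_insert, forall_eq_or_imp]
          exact ⟨hgt, fun a ha => (hL a ha).trans hgt⟩)
        (by
          simp only [Finset.mem_insert, not_or]
          refine ⟨fun h => hne x hxz (h.trans hgx.symm), fun h => ?_⟩
          exact hne (g z) (Finset.ne_of_mem_erase h) (hgR _ h).symm) rfl
      set A := insert x (insert y (L ∪ R.erase z)) with hA
      have hyk : y < k (g z) := hkw y (by simp)
      obtain ⟨e, heA, -, hez⟩ := exists_orderIso_move (L := A) (R := ∅) (x := k (g z)) (x' := z)
        (by
          simp only [hA, Finset.mem_insert, Finset.mem_union]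
          rintro a (rfl | rfl | h | h)
          · exact hxy.trans hyk
          · exact hyk
          · exact (hL a h).trans (hxy.trans hyk)
          · exact hkw a (by simp [Finset.mem_erase.1 h]))
        (by simp)
        (by
          simp only [hA, Finset.mem_insert, Finset.mem_union]
          rintro a (rfl | rfl | h | h)
          · exact hxy.trans hyz
          · exact hyz
          · exact (hL a h).trans (hxy.trans hyz)
          · exact hR'z a h)
        (by simp)
      refine ⟨e.toEquiv * (k * g), G.mul_mem (hG e) (G.mul_mem hkG hgG), fun a ha => ?_,
        fun b hb => ?_, ?_, ?_⟩
      · simp [hgL a ha, hkL a (Finset.mem_insert_of_mem ha), heA a (by simp [hA, ha])]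
      · rcases hRz b hb with h | rfl
        · simp [hgR b h, hkD b (Finset.mem_insert_of_mem h), heA b (by
            simp only [hA, Finset.mem_insert, Finset.mem_union, h, or_true])]
        · simp [hez]
      · simp [hgx, hkD y (by simp), heA y (by simp [hA])]
      · simp [hgy, hkL x (by simp), heA x (by simp [hA])]

theorem exists_mem_move {G : Subgroup (Equiv.Perm ℚ)} (hG : ContainsOrderAut G)
    (h : ∀ r l, SwapsAdjacent G l r) (D : Finset ℚ) {w w' : ℚ} (hw : w ∉ D) (hw' : w' ∉ D) :
    ∃ g ∈ G, (∀ d ∈ D, g d = d) ∧ g w = w' := by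
  have key := fun v (hv : v ∉ D) => exists_mem_above hG (h D.card) ∅ D (by simp) (by omega)
    _ v (by simp) hv rfl
  obtain ⟨g, hg, -, hgD, hgw⟩ := key w hw
  obtain ⟨g', hg', -, hgD', hgw'⟩ := key w' hw'
  obtain ⟨e, he, -, hew⟩ := exists_orderIso_move (R := ∅) hgw (by simp) hgw' (by simp)
  refine ⟨g'⁻¹ * (e.toEquiv * g), G.mul_mem (G.inv_mem hg') (G.mul_mem (hG e) hg),
    fun d hd => ?_, ?_⟩
  · simp [Equiv.symm_apply_eq, hgD d hd, he d hd, hgD' d hd]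
  · simp [hew]

theorem highlyTransitive_of_swaps_left {G : Subgroup (Equiv.Perm ℚ)} (hG : ContainsOrderAut G)
    (h0 : ∀ l, SwapsAdjacent G l 0) : HighlyTransitive G := by
  classical
  intro F f
  induction F using Finset.induction_on with
  | empty => exact fun _ => ⟨1, G.one_mem, by simp⟩
  | insert z F hz ih =>
    intro hf
    obtain ⟨g, hg, hgF⟩ := ih (hf.mono (by simp))
    have hm : ∀ a ∈ F, f a ≠ f z := fun a ha he =>
      hz (hf (by simp [ha]) (by simp) he ▸ ha)
    obtain ⟨k, hk, hkD, hkz⟩ := exists_mem_move hG (swapsAdjacent_of_left hG h0) (F.image f)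
      (w := g z) (w' := f z)
      (by
        simp only [Finset.mem_image, not_exists, not_and]
        intro a ha he
        exact hz (g.injective ((hgF a ha).trans he) ▸ ha))
      (by
        simp only [Finset.mem_image, not_exists, not_and]
        exact hm)
    refine ⟨k * g, G.mul_mem hk hg, ?_⟩
    simp only [Finset.mem_insert, forall_eq_or_imp]
    exact ⟨hkz, fun a ha => by simp [hgF a ha, hkD (f a) (Finset.mem_image_of_mem f ha)]⟩

theorem swaps_right_of_rotates {G : Subgroup (Equiv.Perm ℚ)} (hG : ContainsOrderAut G)
    (h : ∀ k, Rotates G k) (r : ℕ) : SwapsAdjacent G 0 r := by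
  classical
  intro L R x y _ hxy hR hL _
  obtain rfl : L = ∅ := Finset.card_eq_zero.1 (by omega)
  obtain ⟨t, ht, -⟩ := Order.exists_between_finsets (insert y R) ∅ (by simp)
  have hyt := ht y (by simp)
  have hRt : ∀ b ∈ R, b < t := fun b hb => ht b (by simp [hb])
  obtain ⟨g, hg, hgx, hgR, hgy⟩ := h _ R x y t hxy hR hRt hyt le_rfl
  have hxR : ∀ b ∈ insert x R, x - 1 < b := by
    simp only [Finset.mem_insert, forall_eq_or_imp]
    exact ⟨by linarith, fun b hb => by linarith [hR b hb]⟩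
  obtain ⟨k, hk, -, hkR, hkx⟩ := h _ (insert x R) (x - 2) (x - 1) t (by linarith) hxR
    (by
      simp only [Finset.mem_insert, forall_eq_or_imp]
      exact ⟨hxy.trans hyt, hRt⟩) (by linarith) le_rfl
  obtain ⟨e, -, heR, hex, hey⟩ := exists_orderIso_move_pair (L := ∅) (R := R) (x := x - 1)
    (y := x) (x' := x) (y' := y) (by simp) (fun b hb => hxy.trans (hR b hb)) (by linarith)
    (by simp) hR hxy
  have hkt : k⁻¹ t = x - 1 := by rw [Equiv.Perm.inv_eq_iff_eq, hkx]
  have hkR' : ∀ b ∈ insert x R, k⁻¹ b = b := fun b hb => by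
    rw [Equiv.Perm.inv_eq_iff_eq, hkR b hb]
  refine ⟨e.toEquiv * (k⁻¹ * g), G.mul_mem (hG e) (G.mul_mem (G.inv_mem hk) hg), by simp,
    fun b hb => ?_, ?_, ?_⟩
  · simp only [Equiv.Perm.mul_apply, hgR b hb, hkR' b (by simp [hb])]
    exact heR b hb
  · simp only [Equiv.Perm.mul_apply, hgx, hkR' x (by simp)]
    exact hey
  · simp only [Equiv.Perm.mul_apply, hgy, hkt]
    exact hex

/-- The conjugate of `G` by `x ↦ -x`. -/
def mirror (G : Subgroup (Equiv.Perm ℚ)) : Subgroup (Equiv.Perm ℚ) where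
  carrier := {g | Equiv.neg ℚ * g * Equiv.neg ℚ ∈ G}
  mul_mem' {g h} hg hh := by
    have : Equiv.neg ℚ * (g * h) * Equiv.neg ℚ =
        (Equiv.neg ℚ * g * Equiv.neg ℚ) * (Equiv.neg ℚ * h * Equiv.neg ℚ) := by
      ext; simp
    change _ ∈ G
    rw [this]
    exact G.mul_mem hg hh
  one_mem' := by
    have : Equiv.neg ℚ * 1 * Equiv.neg ℚ = 1 := by ext; simp
    change _ ∈ G
    rw [this]
    exact G.one_mem
  inv_mem' {g} hg := by
    have : Equiv.neg ℚ * g⁻¹ * Equiv.neg ℚ = (Equiv.neg ℚ * g * Equiv.neg ℚ)⁻¹ := by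
      ext; simp [mul_assoc]
    change _ ∈ G
    rw [this]
    exact G.inv_mem hg

theorem mem_mirror {G : Subgroup (Equiv.Perm ℚ)} {g : Equiv.Perm ℚ} :
    g ∈ mirror G ↔ Equiv.neg ℚ * g * Equiv.neg ℚ ∈ G := Iff.rfl

theorem conj_mem_mirror {G : Subgroup (Equiv.Perm ℚ)} {g : Equiv.Perm ℚ} (hg : g ∈ G) :
    Equiv.neg ℚ * g * Equiv.neg ℚ ∈ mirror G := by
  rw [mem_mirror]
  convert hg
  ext
  simp

theorem ContainsOrderAut.mirror {G : Subgroup (Equiv.Perm ℚ)} (hG : ContainsOrderAut G) :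
    ContainsOrderAut (mirror G) := fun e =>
  hG ⟨Equiv.neg ℚ * e.toEquiv * Equiv.neg ℚ, by simp⟩

theorem HighlyTransitive.of_mirror {G : Subgroup (Equiv.Perm ℚ)}
    (h : HighlyTransitive (mirror G)) : HighlyTransitive G := by
  intro F f hf
  obtain ⟨g, hg, hgF⟩ := h (F.image fun x => -x) (fun x => -f (-x)) (by
    simp only [Finset.coe_image]
    rintro _ ⟨x, hx, rfl⟩ _ ⟨y, hy, rfl⟩ hxy
    simp only [neg_neg, neg_inj] at hxy ⊢
    exact hf hx hy hxy)
  refine ⟨_, hg, fun x hx => ?_⟩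
  simp [hgF (-x) (by simpa using hx)]

theorem SwapsAdjacent.mirror {G : Subgroup (Equiv.Perm ℚ)} {l r : ℕ} (h : SwapsAdjacent G l r) :
    SwapsAdjacent (mirror G) r l := by
  intro L R x y hL hxy hR hLc hRc
  obtain ⟨g, hg, h1, h2, h3, h4⟩ := h (R.image fun x => -x) (L.image fun x => -x) (-y) (-x)
    (by simpa using hR) (by simpa using hxy) (by simpa using hL)
    (Finset.card_image_le.trans hRc) (Finset.card_image_le.trans hLc)
  exact ⟨_, conj_mem_mirror hg, fun a ha => by simp [h2 (-a) (by simpa using ha)],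
    fun b hb => by simp [h1 (-b) (by simpa using hb)], by simp [h4], by simp [h3]⟩

theorem highlyTransitive_of_swaps_or_rotates {G : Subgroup (Equiv.Perm ℚ)}
    (hG : ContainsOrderAut G) (h : (∀ m, SwapsAdjacent G m 0) ∨ ∀ m, Rotates G m) :
    HighlyTransitive G := by
  rcases h with h | h
  · exact highlyTransitive_of_swaps_left hG h
  · exact (highlyTransitive_of_swaps_left hG.mirror
      fun m => (swaps_right_of_rotates hG h m).mirror).of_mirror

theorem SwapsAdjacent.mono {G : Subgroup (Equiv.Perm ℚ)} {l l' r : ℕ} (h : SwapsAdjacent G l r)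
    (hl : l' ≤ l) : SwapsAdjacent G l' r :=
  fun L R x y hL hxy hR hLc hRc => h L R x y hL hxy hR (hLc.trans hl) hRc

theorem Rotates.mono {G : Subgroup (Equiv.Perm ℚ)} {k k' : ℕ} (h : Rotates G k)
    (hk : k' ≤ k) : Rotates G k' :=
  fun K c x y hc h1 h2 hxy hK => h K c x y hc h1 h2 hxy (hK.trans hk)

theorem exists_orderIso_mapsTo {S T : Finset ℚ} (h : S.card ≤ T.card) :
    ∃ e : ℚ ≃o ℚ, ∀ s ∈ S, e s ∈ T := by
  obtain ⟨e, he⟩ := exists_orderIso_of_lt_iff Finset.univ (S.orderEmbOfFin rfl)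
    (fun i => T.orderEmbOfFin rfl (Fin.castLE h i)) (by simp)
  refine ⟨e, fun s hs => ?_⟩
  obtain ⟨i, rfl⟩ : s ∈ Set.range (S.orderEmbOfFin rfl) := by simpa using hs
  rw [he i (Finset.mem_univ i)]
  exact Finset.orderEmbOfFin_mem _ _ _

theorem swapsAdjacent_of_move {G : Subgroup (Equiv.Perm ℚ)} (hG : ContainsOrderAut G)
    {L : Finset ℚ} {x a : ℚ} {g : Equiv.Perm ℚ} (hg : g ∈ G) (hL : ∀ b ∈ L, b < x)
    (hxa : x < a) (hay : a < g x) (hgL : ∀ b ∈ L, g b = b) (hga : g a = a) :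
    SwapsAdjacent G L.card 0 := by
  classical
  intro L' R' x' y' hL' hxy' hR' hLc hRc
  obtain rfl : R' = ∅ := Finset.card_eq_zero.1 (by omega)
  obtain ⟨e, he⟩ := exists_orderIso_mapsTo hLc
  obtain ⟨e', heL, -, hex, hey⟩ := exists_orderIso_move_pair (L := L'.image e) (R := ∅)
    (x := e x') (y := e y') (x' := x) (y' := a) (by simpa using hL') (by simp)
    (by simpa using hxy') (by simpa using fun b hb => hL _ (he b hb)) (by simp) hxa
  obtain ⟨d, hdL, -, hdx, hdy⟩ := exists_orderIso_move_pair (L := L) (R := ∅)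
    (fun b hb => (hL b hb).trans hxa) (by simp) hay hL (by simp) hxa
  have heL' : ∀ b ∈ L', e' (e b) = e b := fun b hb => heL _ (Finset.mem_image_of_mem e hb)
  have hφ := hG (e.trans e')
  refine ⟨(e.trans e').toEquiv⁻¹ * (d.toEquiv * (g * (e.trans e').toEquiv)),
    G.mul_mem (G.inv_mem hφ) (G.mul_mem (hG d) (G.mul_mem hg hφ)), fun b hb => ?_, by simp,
    ?_, ?_⟩
  · rw [Equiv.Perm.mul_apply, Equiv.Perm.inv_eq_iff_eq]
    simp [heL' b hb, hgL _ (he b hb), hdL _ (he b hb)]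
  · rw [Equiv.Perm.mul_apply, Equiv.Perm.inv_eq_iff_eq]
    simp [hex, hey, hdy]
  · rw [Equiv.Perm.mul_apply, Equiv.Perm.inv_eq_iff_eq]
    simp [hex, hey, hga, hdx]

theorem rotates_of_move {G : Subgroup (Equiv.Perm ℚ)} (hG : ContainsOrderAut G)
    {K : Finset ℚ} {c x : ℚ} {g : Equiv.Perm ℚ} (hg : g ∈ G) (hcx : c < x) (hxy : x < g x)
    (hxK : ∀ a ∈ K, x < a) (hKy : ∀ a ∈ K, a < g x) (hgc : g c = c) (hgK : ∀ a ∈ K, g a = a) :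
    Rotates G K.card := by
  classical
  intro K' c' x' y' hcx' hxK' hKy' hxy' hKc
  obtain ⟨e, he⟩ := exists_orderIso_mapsTo hKc
  obtain ⟨e₁, -, heK, hec, hex⟩ := exists_orderIso_move_pair (L := ∅) (R := K'.image e)
    (x := e c') (y := e x') (x' := c) (y' := x) (by simp) (by simpa using hxK')
    (by simpa using hcx') (by simp) (by simpa using fun b hb => hxK _ (he b hb)) hcx
  have heK' : ∀ b ∈ K', e₁ (e b) = e b := fun b hb => heK _ (Finset.mem_image_of_mem e hb)
  have hxe : x < e₁ (e y') := by rw [← hex]; simpa using hxy'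
  obtain ⟨e₂, heA, -, hey⟩ := exists_orderIso_move (L := insert c (insert x (K'.image e)))
    (R := ∅) (x := e₁ (e y')) (x' := g x)
    (by
      simp only [Finset.mem_insert, Finset.mem_image, forall_eq_or_imp, forall_exists_index,
        and_imp, forall_apply_eq_imp_iff₂]
      refine ⟨hcx.trans hxe, hxe, fun b hb => ?_⟩
      rw [← heK' b hb]
      simpa using hKy' b hb)
    (by simp)
    (by
      simp only [Finset.mem_insert, Finset.mem_image, forall_eq_or_imp, forall_exists_index,
        and_imp, forall_apply_eq_imp_iff₂]
      exact ⟨hcx.trans hxy, hxy, fun b hb => hKy _ (he b hb)⟩)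
    (by simp)
  have hφ := hG (e.trans (e₁.trans e₂))
  have h1 : e₂ c = c := heA c (by simp)
  have h2 : e₂ x = x := heA x (by simp)
  refine ⟨(e.trans (e₁.trans e₂)).toEquiv⁻¹ * (g * (e.trans (e₁.trans e₂)).toEquiv),
    G.mul_mem (G.inv_mem hφ) (G.mul_mem hg hφ), ?_, fun b hb => ?_, ?_⟩
  · rw [Equiv.Perm.mul_apply, Equiv.Perm.inv_eq_iff_eq]
    simp [hec, h1, hgc]
  · have h3 : e₂ (e b) = e b :=
      heA _ (Finset.mem_insert_of_mem (Finset.mem_insert_of_mem (Finset.mem_image_of_mem e hb)))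
    rw [Equiv.Perm.mul_apply, Equiv.Perm.inv_eq_iff_eq]
    simp [heK' b hb, h3, hgK _ (he b hb)]
  · rw [Equiv.Perm.mul_apply, Equiv.Perm.inv_eq_iff_eq]
    simp [hex, h2, hey]

/-- `x, y, z` are in cyclic order. -/
def Cyc (x y z : ℚ) : Prop := (x < y ∧ y < z) ∨ (y < z ∧ z < x) ∨ (z < x ∧ x < y)

theorem Cyc.mirror {x y z : ℚ} (h : Cyc x y z) : Cyc (-z) (-y) (-x) := by
  unfold Cyc at *
  simp only [neg_lt_neg_iff]
  tauto

theorem swaps_or_rotates_of_move {G : Subgroup (Equiv.Perm ℚ)} (hG : ContainsOrderAut G)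
    {m : ℕ} {A : Finset ℚ} {g : Equiv.Perm ℚ} (hg : g ∈ G) (hA : 3 * m ≤ A.card)
    (hgA : ∀ a ∈ A, g a = a) {x : ℚ} (hx : x ∉ A) (hxy : x < g x)
    (ha : ∃ a ∈ A, Cyc x a (g x)) (hb : ∃ b ∈ A, Cyc (g x) b x) :
    (SwapsAdjacent G m 0 ∨ Rotates G m) ∨
      (SwapsAdjacent (mirror G) m 0 ∨ Rotates (mirror G) m) := by
  classical
  obtain ⟨a, ha, hxay⟩ := ha
  obtain ⟨b, hb, hybx⟩ := hb
  have hyA : g x ∉ A := fun h => hxy.ne' (g.injective (hgA _ h))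
  have hxa : x < a ∧ a < g x := by
    unfold Cyc at hxay
    grind
  have hb' : b < x ∨ g x < b := by
    unfold Cyc at hybx
    grind
  set L := A.filter (· < x)
  set K := A.filter fun z => x < z ∧ z < g x
  set R := A.filter (g x < ·)
  have hcard : A.card ≤ L.card + K.card + R.card := by
    have : A ⊆ (L ∪ K) ∪ R := fun z hz => by
      have h1 : z ≠ x := fun h => hx (h ▸ hz)
      have h2 : z ≠ g x := fun h => hyA (h ▸ hz)
      simp only [L, K, R, Finset.mem_union, Finset.mem_filter]
      grind
    exact (Finset.card_le_card this).trans ((Finset.card_union_le _ _).trans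
      (Nat.add_le_add_right (Finset.card_union_le _ _) _))
  have hinv : (Equiv.neg ℚ * g⁻¹ * Equiv.neg ℚ) ∈ mirror G := conj_mem_mirror (G.inv_mem hg)
  have hinvx : (Equiv.neg ℚ * g⁻¹ * Equiv.neg ℚ) (-g x) = -x := by simp
  have hinvA : ∀ a ∈ A, (Equiv.neg ℚ * g⁻¹ * Equiv.neg ℚ) (-a) = -a := fun a ha => by
    have := hgA a ha
    simp [Equiv.symm_apply_eq, this]
  have hneg : ∀ S : Finset ℚ, (S.image fun z => -z).card = S.card := fun S =>
    Finset.card_image_of_injective _ neg_injective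
  have hcase : m ≤ L.card ∨ m ≤ K.card ∨ m ≤ R.card := by omega
  rcases hcase with h | h | h
  · exact Or.inl (Or.inl ((swapsAdjacent_of_move hG (L := L) hg (by simp [L]) hxa.1 hxa.2
      (fun b hb => hgA b (Finset.mem_filter.1 hb).1) (hgA a ha)).mono h))
  · rcases hb' with hb' | hb'
    · refine Or.inl (Or.inr ((rotates_of_move hG (K := K) hg hb' hxy ?_ ?_ (hgA b hb)
        (fun b hb => hgA b (Finset.mem_filter.1 hb).1)).mono h))
      · exact fun a ha => (Finset.mem_filter.1 ha).2.1
      · exact fun a ha => (Finset.mem_filter.1 ha).2.2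
    · refine Or.inr (Or.inr ((rotates_of_move hG.mirror (K := K.image fun z => -z) hinv
        (c := -b) (x := -g x) (neg_lt_neg hb') ?_ ?_ ?_ (hinvA b hb) ?_).mono
        (h.trans (hneg _).ge)))
      · rw [hinvx]; exact neg_lt_neg hxy
      · simp only [Finset.mem_image, forall_exists_index, and_imp, forall_apply_eq_imp_iff₂]
        exact fun a ha => neg_lt_neg (Finset.mem_filter.1 ha).2.2
      · rw [hinvx]
        simp only [Finset.mem_image, forall_exists_index, and_imp, forall_apply_eq_imp_iff₂]
        exact fun a ha => neg_lt_neg (Finset.mem_filter.1 ha).2.1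
      · simp only [Finset.mem_image, forall_exists_index, and_imp, forall_apply_eq_imp_iff₂]
        exact fun b hb => hinvA b (Finset.mem_filter.1 hb).1
  · refine Or.inr (Or.inl ((swapsAdjacent_of_move hG.mirror (L := R.image fun z => -z) hinv
        (x := -g x) (a := -a) ?_ (neg_lt_neg hxa.2) ?_ ?_ (hinvA a ha)).mono
        (h.trans (hneg _).ge)))
    · simp only [Finset.mem_image, forall_exists_index, and_imp, forall_apply_eq_imp_iff₂]
      exact fun a ha => neg_lt_neg (Finset.mem_filter.1 ha).2
    · rw [hinvx]; exact neg_lt_neg hxa.1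
    · simp only [Finset.mem_image, forall_exists_index, and_imp, forall_apply_eq_imp_iff₂]
      exact fun b hb => hinvA b (Finset.mem_filter.1 hb).1

/-- Every element of `G` fixing a set `A` of at least `M` points maps each other point into its
own cyclic interval of the complement of `A`. -/
def FixesIntervals (G : Subgroup (Equiv.Perm ℚ)) (M : ℕ) : Prop :=
  ∀ (A : Finset ℚ) (g : Equiv.Perm ℚ) (x : ℚ), M ≤ A.card → g ∈ G → (∀ a ∈ A, g a = a) → x ∉ A →
    (∀ a ∈ A, ¬ Cyc x a (g x)) ∨ ∀ a ∈ A, ¬ Cyc (g x) a x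

theorem highlyTransitive_or_fixesIntervals {G : Subgroup (Equiv.Perm ℚ)}
    (hG : ContainsOrderAut G) : HighlyTransitive G ∨ ∃ M, FixesIntervals G M := by
  by_contra! hcon
  obtain ⟨hHT, hM⟩ := hcon
  have key : ∀ m, (SwapsAdjacent G m 0 ∨ Rotates G m) ∨
      (SwapsAdjacent (mirror G) m 0 ∨ Rotates (mirror G) m) := by
    intro m
    have := hM (3 * m)
    unfold FixesIntervals at this
    push Not at this
    obtain ⟨A, g, x, hA, hg, hgA, hx, hac, hbc⟩ := this
    rcases lt_trichotomy x (g x) with h | h | h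
    · exact swaps_or_rotates_of_move hG hg hA hgA hx h hac hbc
    · obtain ⟨a, -, ha⟩ := hac
      unfold Cyc at ha
      grind
    · have hyA : g x ∉ A := fun h' => h.ne (g.injective (hgA _ h'))
      exact swaps_or_rotates_of_move hG (g := g⁻¹) (x := g x) (G.inv_mem hg) hA
        (fun a ha => by rw [Equiv.Perm.inv_eq_iff_eq, hgA a ha]) hyA (by simpa using h)
        (by simpa using hbc) (by simpa using hac)
  have h1 : ¬ ((∀ m, SwapsAdjacent G m 0) ∨ ∀ m, Rotates G m) := fun h =>
    hHT (highlyTransitive_of_swaps_or_rotates hG h)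
  have h2 : ¬ ((∀ m, SwapsAdjacent (mirror G) m 0) ∨ ∀ m, Rotates (mirror G) m) := fun h =>
    hHT (highlyTransitive_of_swaps_or_rotates hG.mirror h).of_mirror
  push Not at h1 h2
  obtain ⟨⟨m₁, h₁⟩, m₂, h₂⟩ := h1
  obtain ⟨⟨m₃, h₃⟩, m₄, h₄⟩ := h2
  rcases key (m₁ + m₂ + m₃ + m₄) with (h | h) | (h | h)
  · exact h₁ (h.mono (by omega))
  · exact h₂ (h.mono (by omega))
  · exact h₃ (h.mono (by omega))
  · exact h₄ (h.mono (by omega))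

theorem Cyc.rotate {x y z : ℚ} (h : Cyc x y z) : Cyc y z x := by
  unfold Cyc at *
  tauto

theorem Cyc.not_reverse {x y z : ℚ} (h : Cyc x y z) : ¬ Cyc z y x := by
  unfold Cyc at *
  grind

theorem cyc_or_reverse {x y z : ℚ} (hxy : x ≠ y) (hyz : y ≠ z) (hxz : x ≠ z) :
    Cyc x y z ∨ Cyc z y x := by
  unfold Cyc
  grind

theorem Cyc.trans {a b c d : ℚ} (h : Cyc a b c) (h' : Cyc a c d) : Cyc b c d := by
  unfold Cyc at *
  grind

theorem consecutive_of_fixesIntervals {G : Subgroup (Equiv.Perm ℚ)} (hG : ContainsOrderAut G)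
    {M : ℕ} (hM : FixesIntervals G M) {g : Equiv.Perm ℚ} (hg : g ∈ G) {c : ℕ → ℚ}
    (hc : StrictMono c) (i : ℕ) :
    (∀ j, j ≠ i → j ≠ i + 1 → Cyc (g (c i)) (g (c (i + 1))) (g (c j))) ∨
      ∀ j, j ≠ i → j ≠ i + 1 → Cyc (g (c (i + 1))) (g (c i)) (g (c j)) := by
  classical
  have hinj : Function.Injective fun j => g (c j) := g.injective.comp hc.injective
  have hu : ∀ {j k}, j ≠ k → g (c j) ≠ g (c k) := fun h => hinj.ne h
  by_contra! hcon
  obtain ⟨⟨j, hji, hji', hj⟩, k, hki, hki', hk⟩ := hcon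
  have hj' := (cyc_or_reverse (hu i.lt_succ_self.ne) (hu hji'.symm) (hu hji.symm)).resolve_left hj
  have hk' := (cyc_or_reverse (hu i.lt_succ_self.ne') (hu hki.symm)
    (hu hki'.symm)).resolve_left hk
  set N := i + j + k + M + 3
  obtain ⟨h, hL, hR, hh⟩ := exists_orderIso_move (L := (Finset.range i).image c)
    (R := (Finset.Ioo (i + 1) N).image c) (x := c i) (x' := c (i + 1))
    (by simpa using fun a ha => hc ha)
    (by
      simp only [Finset.mem_image, Finset.mem_Ioo, forall_exists_index, and_imp]
      rintro _ a ha - rfl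
      exact hc (i.lt_succ_self.trans ha))
    (by simpa using fun a ha => hc (lt_trans ha i.lt_succ_self))
    (by
      simp only [Finset.mem_image, Finset.mem_Ioo, forall_exists_index, and_imp]
      rintro _ a ha - rfl
      exact hc ha)
  have hfix : ∀ m, m < N → m ≠ i → m ≠ i + 1 → h (c m) = c m := by
    intro m hm h1 h2
    rcases lt_or_gt_of_ne h1 with h1 | h1
    · exact hL _ (Finset.mem_image_of_mem c (Finset.mem_range.2 h1))
    · exact hR _ (Finset.mem_image_of_mem c (Finset.mem_Ioo.2 ⟨by omega, hm⟩))
  have hmem : ∀ m, m < N → m ≠ i → m ≠ i + 1 →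
      g (c m) ∈ (((Finset.range N).erase i).erase (i + 1)).image fun m => g (c m) :=
    fun m h0 h1 h2 => Finset.mem_image.2 ⟨m, by simp [h0, h1, h2], rfl⟩
  have := hM ((((Finset.range N).erase i).erase (i + 1)).image fun m => g (c m))
    (g * h.toEquiv * g⁻¹) (g (c i))
    (by
      rw [Finset.card_image_of_injective _ hinj, Finset.card_erase_of_mem
        (by simp only [Finset.mem_erase, Finset.mem_range]; omega),
        Finset.card_erase_of_mem (Finset.mem_range.2 (by omega)), Finset.card_range]
      omega)
    (G.mul_mem (G.mul_mem hg (hG h)) (G.inv_mem hg))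
    (by
      simp only [Finset.mem_image, Finset.mem_erase, Finset.mem_range, forall_exists_index,
        and_imp]
      rintro _ m h2 h1 h0 rfl
      simp [hfix m h0 h1 h2])
    (by simp [hc.injective.eq_iff])
  have hmove : (g * h.toEquiv * g⁻¹) (g (c i)) = g (c (i + 1)) := by simp [hh]
  rw [hmove] at this
  rcases this with h' | h'
  · exact h' _ (hmem j (by omega) hji hji') hj'.rotate.rotate
  · exact h' _ (hmem k (by omega) hki hki') hk'.rotate.rotate

theorem cyc_of_consecutive {u : ℕ → ℚ}
    (h : ∀ i j, j ≠ i → j ≠ i + 1 → Cyc (u i) (u (i + 1)) (u j)) {i j k : ℕ} (hij : i < j)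
    (hjk : j < k) : Cyc (u i) (u j) (u k) := by
  induction j, hij using Nat.le_induction with
  | base => exact h i k (by omega) (by omega)
  | succ j hij ih =>
    exact ((h j k (by omega) (by omega)).trans (ih (by omega)).rotate).rotate.rotate

theorem cyc_or_reverse_of_fixesIntervals {G : Subgroup (Equiv.Perm ℚ)} (hG : ContainsOrderAut G)
    {M : ℕ} (hM : FixesIntervals G M) {g : Equiv.Perm ℚ} (hg : g ∈ G) {c : ℕ → ℚ}
    (hc : StrictMono c) :
    (∀ i j k, i < j → j < k → Cyc (g (c i)) (g (c j)) (g (c k))) ∨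
      ∀ i j k, i < j → j < k → Cyc (g (c k)) (g (c j)) (g (c i)) := by
  have key := consecutive_of_fixesIntervals hG hM hg hc
  rcases key 0 with h0 | h0
  · have : ∀ i j, j ≠ i → j ≠ i + 1 → Cyc (g (c i)) (g (c (i + 1))) (g (c j)) := by
      intro i
      induction i with
      | zero => exact h0
      | succ i ih =>
        refine (key (i + 1)).resolve_right fun h => ?_
        exact (ih (i + 2) (by omega) (by omega)).not_reverse (h i (by omega) (by omega))
    exact Or.inl fun i j k hij hjk => cyc_of_consecutive (u := fun i => g (c i)) this hij hjk
  · have : ∀ i j, j ≠ i → j ≠ i + 1 → Cyc (g (c (i + 1))) (g (c i)) (g (c j)) := by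
      intro i
      induction i with
      | zero => exact h0
      | succ i ih =>
        refine (key (i + 1)).resolve_left fun h => ?_
        exact (h i (by omega) (by omega)).not_reverse
          (ih (i + 2) (by omega) (by omega)).rotate
    refine Or.inr fun i j k hij hjk => ?_
    simpa using (cyc_of_consecutive (u := fun i => - g (c i))
      (fun i j h1 h2 => (this i j h1 h2).mirror.rotate) hij hjk).mirror

theorem exists_strictMono_enumeration (C : Finset ℚ) :
    ∃ c : ℕ → ℚ, StrictMono c ∧ ∀ x ∈ C, ∃ i, c i = x := by
  obtain ⟨B, hB, -⟩ := Order.exists_between_finsets C ∅ (by simp)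
  refine ⟨fun i => if h : i < C.card then C.orderEmbOfFin rfl ⟨i, h⟩ else B + i,
    strictMono_nat_of_lt_succ fun i => ?_, fun x hx => ?_⟩
  · by_cases h1 : i + 1 < C.card
    · simp [h1, (Nat.lt_succ_self i).trans h1]
    · by_cases h2 : i < C.card
      · have := hB _ (Finset.orderEmbOfFin_mem C rfl ⟨i, h2⟩)
        simp only [h1, h2, dif_pos, dif_neg, not_false_eq_true]
        push_cast
        have hi : (0 : ℚ) ≤ i := i.cast_nonneg
        linarith
      · simp [h1, h2]
  · obtain ⟨⟨i, hi⟩, rfl⟩ : x ∈ Set.range (C.orderEmbOfFin rfl) := by simpa using hx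
    exact ⟨i, dif_pos hi⟩

def PreservesCyc (g : ℚ → ℚ) : Prop := ∀ x y z, Cyc x y z → Cyc (g x) (g y) (g z)

def ReversesCyc (g : ℚ → ℚ) : Prop := ∀ x y z, Cyc x y z → Cyc (g z) (g y) (g x)

theorem PreservesCyc.comp {f g : ℚ → ℚ} (hf : PreservesCyc f) (hg : PreservesCyc g) :
    PreservesCyc (f ∘ g) := fun _ _ _ h => hf _ _ _ (hg _ _ _ h)

theorem ReversesCyc.comp {f g : ℚ → ℚ} (hf : ReversesCyc f) (hg : ReversesCyc g) :
    PreservesCyc (f ∘ g) := fun _ _ _ h => hf _ _ _ (hg _ _ _ h)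

theorem StrictMono.preservesCyc {f : ℚ → ℚ} (hf : StrictMono f) : PreservesCyc f := by
  intro x y z h
  simpa only [Cyc, hf.lt_iff_lt] using h

theorem reversesCyc_neg : ReversesCyc fun x => -x := fun _ _ _ h => h.mirror

theorem ReversesCyc.neg {g : ℚ → ℚ} (hg : ReversesCyc g) : PreservesCyc fun x => -g x :=
  reversesCyc_neg.comp hg

theorem PreservesCyc.symm {g : Equiv.Perm ℚ} (hg : PreservesCyc g) : PreservesCyc g.symm := by
  intro x y z h
  have h1 : x ≠ y ∧ y ≠ z ∧ x ≠ z := by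
    unfold Cyc at h
    grind
  refine (cyc_or_reverse (g.symm.injective.ne h1.1) (g.symm.injective.ne h1.2.1)
    (g.symm.injective.ne h1.2.2)).resolve_right fun h' => ?_
  have := hg _ _ _ h'
  simp only [Equiv.apply_symm_apply] at this
  exact h.not_reverse this

theorem ReversesCyc.symm {g : Equiv.Perm ℚ} (hg : ReversesCyc g) : ReversesCyc g.symm := by
  intro x y z h
  have h1 : x ≠ y ∧ y ≠ z ∧ x ≠ z := by
    unfold Cyc at h
    grind
  refine (cyc_or_reverse (g.symm.injective.ne h1.1) (g.symm.injective.ne h1.2.1)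
    (g.symm.injective.ne h1.2.2)).resolve_left fun h' => ?_
  have := hg _ _ _ h'
  simp only [Equiv.apply_symm_apply] at this
  exact h.not_reverse this

/-- `g` is increasing on the nonempty initial segment `D` and on its nonempty complement, and
interchanges these two parts. -/
structure CutShift (g : ℚ → ℚ) (D : Set ℚ) : Prop where
  nonempty : ∃ x, x ∈ D
  nonempty_compl : ∃ y, y ∉ D
  lt_of_mem : ∀ x ∈ D, ∀ y ∉ D, x < y
  map_lt_of_mem : ∀ x ∈ D, ∀ y ∉ D, g y < g x
  map_lt_map : ∀ x y, (x ∈ D ↔ y ∈ D) → x < y → g x < g y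

theorem CutShift.preservesCyc {g : ℚ → ℚ} {D : Set ℚ} (h : CutShift g D) : PreservesCyc g := by
  have key : ∀ x y z, x < y → y < z → Cyc (g x) (g y) (g z) := by
    intro x y z hxy hyz
    unfold Cyc
    by_cases hx : x ∈ D <;> by_cases hy : y ∈ D <;> by_cases hz : z ∈ D
    · exact Or.inl ⟨h.map_lt_map x y (by tauto) hxy, h.map_lt_map y z (by tauto) hyz⟩
    · exact Or.inr (Or.inr ⟨h.map_lt_of_mem x hx z hz, h.map_lt_map x y (by tauto) hxy⟩)
    · exact absurd (h.lt_of_mem z hz y hy) hyz.asymm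
    · exact Or.inr (Or.inl ⟨h.map_lt_map y z (by tauto) hyz, h.map_lt_of_mem x hx z hz⟩)
    · exact absurd (h.lt_of_mem y hy x hx) hxy.asymm
    · exact absurd (h.lt_of_mem y hy x hx) hxy.asymm
    · exact absurd (h.lt_of_mem z hz y hy) hyz.asymm
    · exact Or.inl ⟨h.map_lt_map x y (by tauto) hxy, h.map_lt_map y z (by tauto) hyz⟩
  rintro x y z (⟨h1, h2⟩ | ⟨h1, h2⟩ | ⟨h1, h2⟩)
  exacts [key _ _ _ h1 h2, (key _ _ _ h1 h2).rotate.rotate, (key _ _ _ h1 h2).rotate]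

theorem PreservesCyc.strictMono_or_cutShift {g : ℚ → ℚ} (hg : PreservesCyc g)
    (hinj : Function.Injective g) : StrictMono g ∨ ∃ D, CutShift g D := by
  by_cases hm : StrictMono g
  · exact Or.inl hm
  right
  obtain ⟨x, y, hxy, hyx⟩ : ∃ x y, x < y ∧ g y < g x := by
    unfold StrictMono at hm
    push Not at hm
    obtain ⟨x, y, hxy, h⟩ := hm
    exact ⟨x, y, hxy, lt_of_le_of_ne h (hinj.ne hxy.ne')⟩
  have hne : ∀ {a b}, a ≠ b → g a ≠ g b := fun h => hinj.ne h
  have key : ∀ a b c, a < b → b < c →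
      (g a < g b ∧ g b < g c) ∨ (g b < g c ∧ g c < g a) ∨ (g c < g a ∧ g a < g b) :=
    fun a b c h1 h2 => hg a b c (Or.inl ⟨h1, h2⟩)
  refine ⟨{z | z ≤ x ∨ (z < y ∧ g x < g z)}, ⟨x, Or.inl le_rfl⟩, ⟨y, ?_⟩, ?_, ?_, ?_⟩
  · simp [hxy]
  · intro z hz w hw
    simp only [Set.mem_ofPred_eq] at hz hw
    grind
  · intro z hz w hw
    simp only [Set.mem_ofPred_eq] at hz hw
    grind
  · intro z w hzw hlt
    simp only [Set.mem_ofPred_eq] at hzw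
    grind

/-- `G` is closed in the topology of pointwise convergence. -/
def IsFinitelyClosed (G : Subgroup (Equiv.Perm ℚ)) : Prop :=
  ∀ h : Equiv.Perm ℚ, (∀ F : Finset ℚ, ∃ g ∈ G, ∀ x ∈ F, g x = h x) → h ∈ G

theorem exists_mem_eqOn_of_cutShift {G : Subgroup (Equiv.Perm ℚ)} (hG : ContainsOrderAut G)
    {g : Equiv.Perm ℚ} (hg : g ∈ G) {D E : Set ℚ} (hD : CutShift g D) {h : ℚ → ℚ}
    (hE : CutShift h E) (F : Finset ℚ) : ∃ f ∈ G, ∀ x ∈ F, f x = h x := by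
  classical
  obtain ⟨d, hd⟩ := hD.nonempty
  obtain ⟨u, hu⟩ := hD.nonempty_compl
  obtain ⟨x, hx⟩ := hE.nonempty
  obtain ⟨y, hy⟩ := hE.nonempty_compl
  obtain ⟨p, hp, hpmax⟩ := (insert x (F.filter (· ∈ E))).exists_max_image id (by simp)
  obtain ⟨q, hq, hqmin⟩ := (insert y (F.filter (· ∉ E))).exists_min_image id (by simp)
  have hpE : p ∈ E := by
    rcases Finset.mem_insert.1 hp with rfl | h
    exacts [hx, (Finset.mem_filter.1 h).2]
  have hqE : q ∉ E := by
    rcases Finset.mem_insert.1 hq with rfl | h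
    exacts [hy, (Finset.mem_filter.1 h).2]
  obtain ⟨e, -, -, hep, heq⟩ := exists_orderIso_move_pair (L := ∅) (R := ∅) (by simp) (by simp)
    (hE.lt_of_mem p hpE q hqE) (by simp) (by simp) (hD.lt_of_mem d hd u hu)
  have hmem : ∀ a ∈ F, (e a ∈ D ↔ a ∈ E) := by
    intro a ha
    by_cases haE : a ∈ E
    · have : a ≤ p := hpmax a (by simp [ha, haE])
      refine iff_of_true ?_ haE
      by_contra hcon
      have h1 := hD.lt_of_mem d hd _ hcon
      rw [← hep, e.lt_iff_lt] at h1
      exact h1.not_ge this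
    · have : q ≤ a := hqmin a (by simp [ha, haE])
      refine iff_of_false (fun hcon => ?_) haE
      have h1 := hD.lt_of_mem _ hcon u hu
      rw [← heq, e.lt_iff_lt] at h1
      exact h1.not_ge this
  obtain ⟨k, hk⟩ := exists_orderIso_of_lt_iff F (fun a => g (e a)) h (by
    have key : ∀ a ∈ F, ∀ b ∈ F, a < b → (g (e a) < g (e b) ∧ h a < h b) ∨
        (g (e b) < g (e a) ∧ h b < h a) := by
      intro a ha b hb hab
      by_cases hab' : a ∈ E ↔ b ∈ E
      · exact Or.inl ⟨hD.map_lt_map _ _ ((hmem a ha).trans (hab'.trans (hmem b hb).symm))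
          (e.strictMono hab), hE.map_lt_map _ _ hab' hab⟩
      · by_cases haE : a ∈ E
        · have hbE : b ∉ E := by tauto
          exact Or.inr ⟨hD.map_lt_of_mem _ ((hmem a ha).2 haE) _ (by rwa [hmem b hb]),
            hE.map_lt_of_mem _ haE _ hbE⟩
        · have hbE : b ∈ E := by tauto
          exact absurd (hE.lt_of_mem _ hbE _ haE) hab.asymm
    intro a ha b hb
    rcases lt_trichotomy a b with hab | rfl | hab
    · rcases key a ha b hb hab with h' | h'
      · exact iff_of_true h'.1 h'.2
      · exact iff_of_false h'.1.asymm h'.2.asymm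
    · exact iff_of_false (lt_irrefl _) (lt_irrefl _)
    · rcases key b hb a ha hab with h' | h'
      · exact iff_of_false h'.1.asymm h'.2.asymm
      · exact iff_of_true h'.1 h'.2)
  exact ⟨k.toEquiv * (g * e.toEquiv), G.mul_mem (hG k) (G.mul_mem hg (hG e)), hk⟩

theorem mem_of_strictMono {G : Subgroup (Equiv.Perm ℚ)} (hG : ContainsOrderAut G)
    {g : Equiv.Perm ℚ} (hg : StrictMono g) : g ∈ G :=
  hG ⟨g, hg.le_iff_le⟩

theorem mem_of_preservesCyc {G : Subgroup (Equiv.Perm ℚ)} (hG : ContainsOrderAut G)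
    (hcl : IsFinitelyClosed G) {g : Equiv.Perm ℚ} (hg : g ∈ G) {D : Set ℚ} (hD : CutShift g D)
    {h : Equiv.Perm ℚ} (hh : PreservesCyc h) : h ∈ G := by
  rcases hh.strictMono_or_cutShift h.injective with hm | ⟨E, hE⟩
  · exact mem_of_strictMono hG hm
  · exact hcl h fun F => exists_mem_eqOn_of_cutShift hG hg hD hE F

theorem exists_cutShift_mem {G : Subgroup (Equiv.Perm ℚ)} (hG : ContainsOrderAut G)
    {g : Equiv.Perm ℚ} (hg : g ∈ G) (hcyc : PreservesCyc g ∨ ReversesCyc g)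
    (hmono : ¬ StrictMono g) (hanti : ¬ StrictAnti g) : ∃ f ∈ G, ∃ D, CutShift f D := by
  rcases hcyc with h | h
  · exact ⟨g, hg, (h.strictMono_or_cutShift g.injective).resolve_left hmono⟩
  · obtain ⟨D, hD⟩ := (h.neg.strictMono_or_cutShift
      (neg_injective.comp g.injective)).resolve_left
      fun hm => hanti fun a b hab => neg_lt_neg_iff.1 (hm hab)
    obtain ⟨d, hd⟩ := hD.nonempty
    obtain ⟨u, hu⟩ := hD.nonempty_compl
    have hd' : d - 1 ∈ D := by
      by_contra hcon
      linarith [hD.lt_of_mem d hd _ hcon]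
    have hgd : g d < g (d - 1) := neg_lt_neg_iff.1 (hD.map_lt_map _ _ (by tauto) (by linarith))
    have hgu : g d < g u := neg_lt_neg_iff.1 (hD.map_lt_of_mem d hd u hu)
    obtain ⟨e, -, -, hed, heu⟩ := exists_orderIso_move_pair (L := ∅) (R := ∅) (by simp) (by simp)
      hgd (by simp) (by simp) (hD.lt_of_mem d hd u hu)
    refine ⟨g * (e.toEquiv * g), G.mul_mem hg (G.mul_mem (hG e) hg),
      (PreservesCyc.strictMono_or_cutShift ?_ (Equiv.injective _)).resolve_left fun hm => ?_⟩
    · exact fun x y z hxyz => h _ _ _ (e.strictMono.preservesCyc _ _ _ (h _ _ _ hxyz))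
    · have := hm (show d - 1 < d by linarith)
      simp only [Equiv.Perm.mul_apply, RelIso.coe_fn_toEquiv, hed, heu] at this
      exact this.asymm hgu

theorem preservesCyc_or_reversesCyc {G : Subgroup (Equiv.Perm ℚ)} (hG : ContainsOrderAut G)
    (hHT : ¬ HighlyTransitive G) {g : Equiv.Perm ℚ} (hg : g ∈ G) :
    PreservesCyc g ∨ ReversesCyc g := by
  obtain ⟨M, hM⟩ := (highlyTransitive_or_fixesIntervals hG).resolve_left hHT
  by_contra! hcon
  unfold PreservesCyc ReversesCyc at hcon
  push Not at hcon
  obtain ⟨⟨x, y, z, hxyz, h1⟩, x', y', z', hxyz', h2⟩ := hcon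
  obtain ⟨c, hc, hcC⟩ := exists_strictMono_enumeration {x, y, z, x', y', z'}
  obtain ⟨i, rfl⟩ := hcC x (by simp)
  obtain ⟨j, rfl⟩ := hcC y (by simp)
  obtain ⟨k, rfl⟩ := hcC z (by simp)
  obtain ⟨i', rfl⟩ := hcC x' (by simp)
  obtain ⟨j', rfl⟩ := hcC y' (by simp)
  obtain ⟨k', rfl⟩ := hcC z' (by simp)
  rcases cyc_or_reverse_of_fixesIntervals hG hM hg hc with h' | h'
  · rcases hxyz with ⟨h3, h4⟩ | ⟨h3, h4⟩ | ⟨h3, h4⟩ <;> rw [hc.lt_iff_lt] at h3 h4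
    exacts [h1 (h' _ _ _ h3 h4), h1 (h' _ _ _ h3 h4).rotate.rotate, h1 (h' _ _ _ h3 h4).rotate]
  · rcases hxyz' with ⟨h3, h4⟩ | ⟨h3, h4⟩ | ⟨h3, h4⟩ <;> rw [hc.lt_iff_lt] at h3 h4
    exacts [h2 (h' _ _ _ h3 h4), h2 (h' _ _ _ h3 h4).rotate, h2 (h' _ _ _ h3 h4).rotate.rotate]

/-- The group of permutations preserving a relation. -/
def autRel {M : Type*} {n : ℕ} (R : (Fin n → M) → Prop) : Subgroup (Equiv.Perm M) where
  carrier := {g | ∀ v, R (g ∘ v) ↔ R v}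
  mul_mem' {g h} hg hh v := (hg (h ∘ v)).trans (hh v)
  one_mem' _ := Iff.rfl
  inv_mem' {g} hg v := by
    have := hg (⇑g⁻¹ ∘ v)
    rw [← this]
    simp [← Function.comp_assoc]

theorem isFinitelyClosed_autRel {n : ℕ} (R : (Fin n → ℚ) → Prop) :
    IsFinitelyClosed (autRel R) := by
  intro h hh v
  obtain ⟨g, hg, hgv⟩ := hh (Finset.univ.image v)
  have : h ∘ v = g ∘ v := funext fun i => (hgv (v i) (by simp)).symm
  rw [this]
  exact hg v

theorem mem_autRel_ltRel {g : Equiv.Perm ℚ} : g ∈ autRel ltRel ↔ StrictMono g :=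
  ⟨fun h x y hxy => (h ![x, y]).2 hxy, fun h _ => h.lt_iff_lt⟩

theorem mem_autRel_bRel {g : Equiv.Perm ℚ} : g ∈ autRel bRel ↔ StrictMono g ∨ StrictAnti g := by
  refine ⟨fun h => ?_, ?_⟩
  · have hb : ∀ x y z, x < y → y < z → (g x < g y ∧ g y < g z) ∨ (g z < g y ∧ g y < g x) :=
      fun x y z hxy hyz => (h ![x, y, z]).2 (Or.inl ⟨hxy, hyz⟩)
    by_contra hcon
    obtain ⟨x, y, z, hxy, hyz, hg⟩ := not_monotone_not_antitone_iff_exists_le_le.1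
      (not_or.1 fun h' => hcon (h'.imp (fun h' => h'.strictMono_of_injective g.injective)
        fun h' => h'.strictAnti_of_injective g.injective))
    have h1 : x ≠ y := by grind
    have h2 : y ≠ z := by grind
    have := hb x y z (hxy.lt_of_ne h1) (hyz.lt_of_ne h2)
    grind
  · rintro (h | h) v
    · simp [bRel, h.lt_iff_lt]
    · simp [bRel, h.lt_iff_gt]
      tauto

theorem mem_autRel_cRel {g : Equiv.Perm ℚ} : g ∈ autRel cRel ↔ PreservesCyc g := by
  refine ⟨fun h x y z hxyz => (h ![x, y, z]).2 hxyz, fun h v => ⟨fun hv => ?_, h _ _ _⟩⟩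
  have : Cyc (v 0) (v 1) (v 2) := by simpa using h.symm (g (v 0)) (g (v 1)) (g (v 2)) hv
  exact this

theorem mem_autRel_sRel_of_preservesCyc_or_reversesCyc {g : Equiv.Perm ℚ}
    (h : PreservesCyc g ∨ ReversesCyc g) : g ∈ autRel sRel := by
  intro v
  rcases h with h | h
  · have key : ∀ x y z, Cyc (g x) (g y) (g z) ↔ Cyc x y z := fun x y z =>
      ⟨fun h' => by simpa using h.symm _ _ _ h', h x y z⟩
    exact or_congr (and_congr (key _ _ _) (key _ _ _)) (and_congr (key _ _ _) (key _ _ _))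
  · have key : ∀ x y z, Cyc (g x) (g y) (g z) ↔ Cyc z y x := fun x y z =>
      ⟨fun h' => by simpa using h.symm _ _ _ h', h z y x⟩
    refine (or_congr (and_congr (key _ _ _) (key _ _ _))
      (and_congr (key _ _ _) (key _ _ _))).trans ?_
    change (Cyc _ _ _ ∧ Cyc _ _ _) ∨ (Cyc _ _ _ ∧ Cyc _ _ _) ↔
      (Cyc _ _ _ ∧ Cyc _ _ _) ∨ (Cyc _ _ _ ∧ Cyc _ _ _)
    tauto

theorem containsOrderAut_autRel_sRel : ContainsOrderAut (autRel sRel) := fun e =>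
  mem_autRel_sRel_of_preservesCyc_or_reversesCyc (Or.inl e.strictMono.preservesCyc)

theorem eq_top_of_highlyTransitive {G : Subgroup (Equiv.Perm ℚ)} (hcl : IsFinitelyClosed G)
    (h : HighlyTransitive G) : G = ⊤ :=
  (Subgroup.eq_top_iff' G).2 fun g => hcl g fun F => h F g g.injective.injOn

theorem swap_notMem_autRel_sRel : Equiv.swap (0 : ℚ) 1 ∉ autRel sRel := by
  intro hg
  have h2 : Equiv.swap (0 : ℚ) 1 2 = 2 :=
    Equiv.swap_apply_of_ne_of_ne (by norm_num) (by norm_num)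
  have h3 : Equiv.swap (0 : ℚ) 1 3 = 3 :=
    Equiv.swap_apply_of_ne_of_ne (by norm_num) (by norm_num)
  have := (hg ![0, 1, 2, 3]).2 (by simp [sRel, cRel]; norm_num)
  simp [sRel, cRel, h2, h3] at this
  norm_num at this

theorem not_highlyTransitive_autRel_sRel : ¬ HighlyTransitive (autRel sRel) := fun h =>
  swap_notMem_autRel_sRel
    (eq_top_of_highlyTransitive (isFinitelyClosed_autRel sRel) h ▸ Subgroup.mem_top _)

theorem mem_autRel_sRel {g : Equiv.Perm ℚ} :
    g ∈ autRel sRel ↔ PreservesCyc g ∨ ReversesCyc g :=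
  ⟨fun hg => preservesCyc_or_reversesCyc containsOrderAut_autRel_sRel
    not_highlyTransitive_autRel_sRel hg, mem_autRel_sRel_of_preservesCyc_or_reversesCyc⟩

/-- The closed groups of permutations of `ℚ` containing all order automorphisms. -/
theorem eq_autRel_or_top {G : Subgroup (Equiv.Perm ℚ)} (hG : ContainsOrderAut G)
    (hcl : IsFinitelyClosed G) :
    G = autRel ltRel ∨ G = autRel bRel ∨ G = autRel cRel ∨ G = autRel sRel ∨ G = ⊤ := by
  by_cases hHT : HighlyTransitive G
  · exact Or.inr (Or.inr (Or.inr (Or.inr (eq_top_of_highlyTransitive hcl hHT))))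
  have hcyc : ∀ g ∈ G, PreservesCyc g ∨ ReversesCyc g := fun g hg =>
    preservesCyc_or_reversesCyc hG hHT hg
  by_cases hlt : ∀ g ∈ G, StrictMono g
  · refine Or.inl (le_antisymm (fun g hg => mem_autRel_ltRel.2 (hlt g hg)) fun g hg => ?_)
    exact mem_of_strictMono hG (mem_autRel_ltRel.1 hg)
  by_cases hb : ∀ g ∈ G, StrictMono g ∨ StrictAnti g
  · refine Or.inr (Or.inl (le_antisymm (fun g hg => mem_autRel_bRel.2 (hb g hg)) fun g hg => ?_))
    rcases mem_autRel_bRel.1 hg with h | h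
    · exact mem_of_strictMono hG h
    · push Not at hlt
      obtain ⟨r, hr, hrm⟩ := hlt
      have hra := (hb r hr).resolve_left hrm
      have := mem_of_strictMono hG (g := r * g) fun x y hxy => hra (h hxy)
      exact (G.mul_mem_cancel_left hr).1 this
  push Not at hb
  obtain ⟨f, hf, hfm, hfa⟩ := hb
  obtain ⟨g, hg, D, hD⟩ := exists_cutShift_mem hG hf (hcyc f hf) hfm hfa
  have hmem : ∀ h : Equiv.Perm ℚ, PreservesCyc h → h ∈ G := fun h hh =>
    mem_of_preservesCyc hG hcl hg hD hh
  by_cases hc : ∀ g ∈ G, PreservesCyc g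
  · exact Or.inr (Or.inr (Or.inl (le_antisymm (fun g hg => mem_autRel_cRel.2 (hc g hg))
      fun g hg => hmem g (mem_autRel_cRel.1 hg))))
  · refine Or.inr (Or.inr (Or.inr (Or.inl (le_antisymm
      (fun g hg => mem_autRel_sRel.2 (hcyc g hg)) fun h hh => ?_))))
    rcases mem_autRel_sRel.1 hh with h1 | h1
    · exact hmem h h1
    · push Not at hc
      obtain ⟨r, hr, hrc⟩ := hc
      have hrr := (hcyc r hr).resolve_left hrc
      exact (G.mul_mem_cancel_left hr).1 (hmem (r * h) (hrr.comp h1))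

theorem exists_perm_cutShift : ∃ (g : Equiv.Perm ℚ) (D : Set ℚ), CutShift g D := by
  classical
  let D : Set ℚ := {x | (x : ℝ) < √2}
  have hne : ∀ x : ℚ, (x : ℝ) ≠ √2 := fun x h => irrational_sqrt_two ⟨x, h⟩
  have hlt : ∀ x ∉ D, √2 < x := fun x hx => (not_lt.1 hx).lt_of_ne (hne x).symm
  have : Nonempty D := ⟨0, by simp [D]⟩
  have : Nonempty (Dᶜ : Set ℚ) := ⟨2, by
    simp only [D, Set.mem_compl_iff, Set.mem_ofPred_eq, not_lt]
    push_cast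
    exact (Real.sqrt_le_left (by norm_num)).2 (by norm_num)⟩
  have : NoMaxOrder D := ⟨fun x => by
    obtain ⟨q, h1, h2⟩ := exists_rat_btwn (show (x.1 : ℝ) < √2 from x.2)
    exact ⟨⟨q, h2⟩, by exact_mod_cast h1⟩⟩
  have : NoMinOrder (Dᶜ : Set ℚ) := ⟨fun x => by
    obtain ⟨q, h1, h2⟩ := exists_rat_btwn (hlt x.1 x.2)
    exact ⟨⟨q, h1.not_gt⟩, by exact_mod_cast h2⟩⟩
  have : NoMinOrder D := ⟨fun x => by
    refine ⟨⟨x - 1, ?_⟩, ?_⟩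
    · have := x.2
      simp only [D, Set.mem_ofPred_eq] at this ⊢
      push_cast
      linarith
    · exact Subtype.coe_lt_coe.1 (sub_one_lt x.1)⟩
  have : NoMaxOrder (Dᶜ : Set ℚ) := ⟨fun x => by
    refine ⟨⟨x + 1, ?_⟩, ?_⟩
    · have := x.2
      simp only [D, Set.mem_compl_iff, Set.mem_ofPred_eq] at this ⊢
      push_cast
      linarith
    · exact Subtype.coe_lt_coe.1 (lt_add_one x.1)⟩
  have : DenselyOrdered D := ⟨fun x y hxy => by
    obtain ⟨q, h1, h2⟩ := exists_between (Subtype.coe_lt_coe.2 hxy)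
    exact ⟨⟨q, lt_trans (Rat.cast_lt.2 h2) (show (y.1 : ℝ) < √2 from y.2)⟩, h1, h2⟩⟩
  have : DenselyOrdered (Dᶜ : Set ℚ) := ⟨fun x y hxy => by
    obtain ⟨q, h1, h2⟩ := exists_between (Subtype.coe_lt_coe.2 hxy)
    exact ⟨⟨q, ((hlt x.1 x.2).trans (Rat.cast_lt.2 h1)).not_gt⟩, h1, h2⟩⟩
  obtain ⟨e⟩ := Order.iso_of_countable_dense D (Dᶜ : Set ℚ)
  let f : ℚ → ℚ := fun x => if h : x ∈ D then e ⟨x, h⟩ else e.symm ⟨x, h⟩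
  have f_pos : ∀ x (h : x ∈ D), f x = e ⟨x, h⟩ := fun x h => dif_pos h
  have f_neg : ∀ x (h : x ∉ D), f x = e.symm ⟨x, h⟩ := fun x h => dif_neg h
  have hf : Function.Involutive f := by
    intro x
    by_cases h : x ∈ D
    · rw [f_pos x h, f_neg _ (e ⟨x, h⟩).2]
      simp
    · rw [f_neg x h, f_pos _ (e.symm ⟨x, h⟩).2]
      simp
  refine ⟨hf.toPerm, D, ⟨0, by simp [D]⟩, ?_, ?_, ?_, ?_⟩
  · obtain ⟨y⟩ := ‹Nonempty (Dᶜ : Set ℚ)›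
    exact ⟨y, y.2⟩
  · exact fun x hx y hy => Rat.cast_lt.1 (lt_trans hx (hlt y hy))
  · intro x hx y hy
    change f y < f x
    rw [f_pos x hx, f_neg y hy]
    exact Rat.cast_lt.1 (lt_trans (e.symm ⟨y, hy⟩).2 (hlt _ (e ⟨x, hx⟩).2))
  · intro x y hxy hlt
    change f x < f y
    by_cases hx : x ∈ D
    · rw [f_pos x hx, f_pos y (hxy.1 hx)]
      exact e.strictMono hlt
    · rw [f_neg x hx, f_neg y (mt hxy.2 hx)]
      exact e.symm.strictMono hlt

/-- The automorphism groups in `eq_autRel_or_top` are pairwise distinct. -/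
theorem pairwise_ne_autRel :
    autRel ltRel ≠ autRel bRel ∧ autRel ltRel ≠ autRel cRel ∧ autRel ltRel ≠ autRel sRel ∧
    autRel ltRel ≠ ⊤ ∧ autRel bRel ≠ autRel cRel ∧ autRel bRel ≠ autRel sRel ∧
    autRel bRel ≠ ⊤ ∧ autRel cRel ≠ autRel sRel ∧ autRel cRel ≠ ⊤ ∧ autRel sRel ≠ ⊤ := by
  have hna : StrictAnti (Equiv.neg ℚ) := fun x y h => neg_lt_neg h
  have hnl : Equiv.neg ℚ ∉ autRel ltRel := fun h =>
    (hna zero_lt_one).asymm (mem_autRel_ltRel.1 h zero_lt_one)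
  have hnb : Equiv.neg ℚ ∈ autRel bRel := mem_autRel_bRel.2 (Or.inr hna)
  have hns : Equiv.neg ℚ ∈ autRel sRel := mem_autRel_sRel.2 (Or.inr reversesCyc_neg)
  have hnc : Equiv.neg ℚ ∉ autRel cRel := fun h =>
    have h1 : Cyc 0 1 2 := Or.inl ⟨by norm_num, by norm_num⟩
    (reversesCyc_neg _ _ _ h1).not_reverse (mem_autRel_cRel.1 h _ _ _ h1)
  obtain ⟨g, D, hD⟩ := exists_perm_cutShift
  have hgb : g ∉ autRel bRel := by
    obtain ⟨x, hx⟩ := hD.nonempty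
    obtain ⟨y, hy⟩ := hD.nonempty_compl
    have hxy := hD.lt_of_mem x hx y hy
    have hgxy := hD.map_lt_of_mem x hx y hy
    have hy' : y + 1 ∉ D := fun h => by linarith [hD.lt_of_mem _ h y hy]
    have hyy : y < y + 1 := lt_add_one y
    have hgyy := hD.map_lt_map y (y + 1) (by tauto) hyy
    rw [mem_autRel_bRel]
    rintro (h | h)
    · exact hgxy.asymm (h hxy)
    · exact hgyy.asymm (h hyy)
  have hgl : g ∉ autRel ltRel := fun h =>
    hgb (mem_autRel_bRel.2 (Or.inl (mem_autRel_ltRel.1 h)))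
  have hgc : g ∈ autRel cRel := mem_autRel_cRel.2 hD.preservesCyc
  have hgs : g ∈ autRel sRel := mem_autRel_sRel.2 (Or.inl hD.preservesCyc)
  refine ⟨?_, ?_, ?_, ?_, ?_, ?_, ?_, ?_, ?_, ?_⟩
  · exact fun h => hnl (h ▸ hnb)
  · exact fun h => hgl (h ▸ hgc)
  · exact fun h => hgl (h ▸ hgs)
  · exact fun h => hgl (h ▸ Subgroup.mem_top g)
  · exact fun h => hnc (h ▸ hnb)
  · exact fun h => hgb (h ▸ hgs)
  · exact fun h => hgb (h ▸ Subgroup.mem_top g)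
  · exact fun h => hnc (h ▸ hns)
  · exact fun h => hnc (h ▸ Subgroup.mem_top (Equiv.neg ℚ))
  · exact fun h => swap_notMem_autRel_sRel (h ▸ Subgroup.mem_top _)

section Categoricity

variable {M : Type*} (L : FirstOrder.Language) [L.Structure M]

/-- `v` and `w` have the same type over the empty set. -/
def SameType {α : Type*} (v w : α → M) : Prop :=
  ∀ S : Set (α → M), (∅ : Set M).Definable L S → (v ∈ S ↔ w ∈ S)

/-- For every `k` there are only finitely many `∅`-definable `k`-ary relations. -/
def FinitelyManyDefinable (M : Type*) [L.Structure M] : Prop :=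
  ∀ k, {S : Set (Fin k → M) | (∅ : Set M).Definable L S}.Finite

/-- A finite correspondence that preserves types. -/
def IsPartialElementary (f : Finset (M × M)) : Prop :=
  ∀ (k : ℕ) (t : Fin k → M × M), (∀ j, t j ∈ f) → SameType L (Prod.fst ∘ t) (Prod.snd ∘ t)

variable {L}

theorem SameType.symm {α : Type*} {v w : α → M} (h : SameType L v w) : SameType L w v :=
  fun S hS => (h S hS).symm

theorem SameType.comp {α β : Type*} {v w : α → M} (h : SameType L v w) (σ : β → α) :
    SameType L (v ∘ σ) (w ∘ σ) :=
  fun _ hS => h _ (hS.preimage_comp σ)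

theorem definable_sUnion_of_finite {α : Type*} {C : Set (Set (α → M))} (hC : C.Finite)
    (h : ∀ S ∈ C, (∅ : Set M).Definable L S) :
    (∅ : Set M).Definable L (⋃₀ C) := by
  have : Finite C := hC
  rw [Set.sUnion_eq_iUnion]
  exact Set.definable_iUnion_of_finite fun S => h S.1 S.2

theorem definable_setOf_sameType (hfin : FinitelyManyDefinable L M) {k : ℕ} (v : Fin k → M) :
    (∅ : Set M).Definable L {w | SameType L v w} := by
  have h : {w | SameType L v w} = ⋂ T : {S : Set (Fin k → M) //
      (∅ : Set M).Definable L S ∧ v ∈ S}, T.1 := by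
    ext w
    simp only [Set.mem_ofPred_eq, Set.mem_iInter, Subtype.forall]
    refine ⟨fun h S hS => (h S hS.1).1 hS.2, fun h S hS => ⟨fun hv => h S ⟨hS, hv⟩, ?_⟩⟩
    intro hw
    by_contra hv
    exact h Sᶜ ⟨hS.compl, hv⟩ hw
  have : Finite {S : Set (Fin k → M) // (∅ : Set M).Definable L S ∧ v ∈ S} :=
    (hfin k).subset fun S hS => hS.1
  rw [h]
  exact Set.definable_iInter_of_finite fun S => S.2.1

theorem SameType.exists_cons (hfin : FinitelyManyDefinable L M) {k : ℕ} {v w : Fin k → M}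
    (h : SameType L v w) (a : M) :
    ∃ b, SameType L (Fin.cons a v : Fin (k + 1) → M) (Fin.cons b w) := by
  have hdef := (definable_setOf_sameType hfin (Fin.cons a v : Fin (k + 1) → M)).image_comp Fin.succ
  obtain ⟨u, hu, rfl⟩ := (h _ hdef).1 ⟨Fin.cons a v, fun _ _ => Iff.rfl, by ext; simp⟩
  refine ⟨u 0, ?_⟩
  have : (Fin.cons (u 0) (u ∘ Fin.succ) : Fin (k + 1) → M) = u := Fin.cons_self_tail u
  rwa [this]

theorem IsPartialElementary.exists_insert [DecidableEq M] (hfin : FinitelyManyDefinable L M)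
    {f : Finset (M × M)} (hf : IsPartialElementary L f) (a : M) :
    ∃ b, IsPartialElementary L (insert (a, b) f) := by
  let t₀ : Fin f.card → M × M := fun i => (f.equivFin.symm i).1
  obtain ⟨b, hb⟩ := (hf _ t₀ fun j => (f.equivFin.symm j).2).exists_cons hfin a
  refine ⟨b, fun k t ht => ?_⟩
  have : ∀ j, ∃ i, (Fin.cons (a, b) t₀ : Fin (f.card + 1) → M × M) i = t j := by
    intro j
    rcases Finset.mem_insert.1 (ht j) with h | h
    · exact ⟨0, h.symm⟩
    · exact ⟨(f.equivFin ⟨t j, h⟩).succ, by simp [t₀]⟩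
  choose σ hσ using this
  have h1 : Prod.fst ∘ t = (Fin.cons a (Prod.fst ∘ t₀) : Fin (f.card + 1) → M) ∘ σ := by
    ext j
    rw [Function.comp_apply, ← hσ j, Function.comp_apply]
    cases σ j using Fin.cases <;> rfl
  have h2 : Prod.snd ∘ t = (Fin.cons b (Prod.snd ∘ t₀) : Fin (f.card + 1) → M) ∘ σ := by
    ext j
    rw [Function.comp_apply, ← hσ j, Function.comp_apply]
    cases σ j using Fin.cases <;> rfl
  rw [h1, h2]
  exact hb.comp σ

theorem IsPartialElementary.image_swap [DecidableEq M] {f : Finset (M × M)}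
    (hf : IsPartialElementary L f) : IsPartialElementary L (f.image Prod.swap) := by
  intro k t ht
  refine (hf k (Prod.swap ∘ t) fun j => ?_).symm
  obtain ⟨p, hp, hpt⟩ := Finset.mem_image.1 (ht j)
  simpa [← hpt] using hp

theorem IsPartialElementary.exists_insert' [DecidableEq M] (hfin : FinitelyManyDefinable L M)
    {f : Finset (M × M)} (hf : IsPartialElementary L f) (b : M) :
    ∃ a, IsPartialElementary L (insert (a, b) f) := by
  obtain ⟨a, ha⟩ := hf.image_swap.exists_insert hfin b
  refine ⟨a, ?_⟩
  have := ha.image_swap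
  rwa [Finset.image_insert, Finset.image_image, Prod.swap_swap_eq, Finset.image_id] at this

theorem IsPartialElementary.eq_iff {f : Finset (M × M)} (hf : IsPartialElementary L f)
    {p q : M × M} (hp : p ∈ f) (hq : q ∈ f) : p.1 = q.1 ↔ p.2 = q.2 := by
  have h := hf 2 ![p, q] (by
    intro j
    fin_cases j
    exacts [hp, hq]) {v | v 0 = v 1}
    (Set.empty_definable_iff.2 ⟨(Term.var 0).equal (Term.var 1), by ext; simp⟩)
  simpa using h

/-- In a countable relational structure with finitely many definable relations, tuples of the same
type are conjugate. -/
theorem SameType.exists_perm [Countable M] (hfin : FinitelyManyDefinable L M)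
    {k : ℕ} {v w : Fin k → M} (h : SameType L v w) :
    ∃ e : Equiv.Perm M, (∀ (n : ℕ) (u : Fin n → M), SameType L u (e ∘ u)) ∧ e ∘ v = w := by
  classical
  have := Encodable.ofCountable M
  let P := {f : Finset (M × M) // IsPartialElementary L f}
  let p₀ : P := ⟨Finset.univ.image fun i => (v i, w i), fun m t ht => by
    have : ∀ j, ∃ i, (v i, w i) = t j := fun j => by simpa using ht j
    choose σ hσ using this
    convert h.comp σ using 1 <;> ext j <;> simp [← hσ j]⟩
  let cof : M ⊕ M → Order.Cofinal P := fun x => match x with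
    | Sum.inl a => ⟨{f | ∃ b, (a, b) ∈ f.1}, fun f => by
        obtain ⟨b, hb⟩ := f.2.exists_insert hfin a
        exact ⟨⟨_, hb⟩, ⟨b, Finset.mem_insert_self _ _⟩, Finset.subset_insert _ _⟩⟩
    | Sum.inr b => ⟨{f | ∃ a, (a, b) ∈ f.1}, fun f => by
        obtain ⟨a, ha⟩ := f.2.exists_insert' hfin b
        exact ⟨⟨_, ha⟩, ⟨a, Finset.mem_insert_self _ _⟩, Finset.subset_insert _ _⟩⟩
  let I := Order.idealOfCofinals p₀ cof
  have hI : ∀ (n : ℕ) (t : Fin n → M × M), (∀ j, ∃ f ∈ I, t j ∈ f.1) →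
      ∃ f ∈ I, ∀ j, t j ∈ f.1 := by
    intro n t ht
    choose f hfI hf using ht
    have : Nonempty { x // x ∈ (I : Set P) } := ⟨⟨p₀, Order.mem_idealOfCofinals p₀ cof⟩⟩
    have hdir := directedOn_iff_directed.1 I.directed
    obtain ⟨g, hg⟩ := hdir.finset_le (Finset.univ.image fun j => (⟨f j, hfI j⟩ : (I : Set P)))
    exact ⟨g.1, g.2, fun j => hg _ (Finset.mem_image_of_mem _ (Finset.mem_univ j)) (hf j)⟩
  have hforth : ∀ a, ∃ b, ∃ f ∈ I, (a, b) ∈ f.1 := fun a => by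
    obtain ⟨f, ⟨b, hb⟩, hf⟩ := Order.cofinal_meets_idealOfCofinals p₀ cof (Sum.inl a)
    exact ⟨b, f, hf, hb⟩
  have hback : ∀ b, ∃ a, ∃ f ∈ I, (a, b) ∈ f.1 := fun b => by
    obtain ⟨f, ⟨a, ha⟩, hf⟩ := Order.cofinal_meets_idealOfCofinals p₀ cof (Sum.inr b)
    exact ⟨a, f, hf, ha⟩
  have huniq : ∀ p q : M × M, (∃ f ∈ I, p ∈ f.1) → (∃ f ∈ I, q ∈ f.1) →
      (p.1 = q.1 ↔ p.2 = q.2) := by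
    intro p q hp hq
    obtain ⟨f, -, hf⟩ := hI 2 ![p, q] (by
      intro j
      fin_cases j
      exacts [hp, hq])
    exact f.2.eq_iff (hf 0) (hf 1)
  choose e he using hforth
  have hbij : Function.Bijective e := by
    refine ⟨fun a a' haa' => (huniq _ _ (he a) (he a')).2 haa', fun b => ?_⟩
    obtain ⟨a, ha⟩ := hback b
    exact ⟨a, (huniq _ _ (he a) ha).1 rfl⟩
  refine ⟨Equiv.ofBijective e hbij, fun n u => ?_, ?_⟩
  · obtain ⟨f, -, hf⟩ := hI n (fun j => (u j, e (u j))) fun j => he (u j)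
    exact f.2 n _ hf
  · ext i
    exact (huniq (v i, e (v i)) (v i, w i) (he _) ⟨p₀, Order.mem_idealOfCofinals p₀ cof,
      Finset.mem_image_of_mem (fun i => (v i, w i)) (Finset.mem_univ i)⟩).1 rfl

/-- `g` is an automorphism of the relational structure on `M`. -/
def PreservesRelMap (L : FirstOrder.Language) [L.Structure M] (g : Equiv.Perm M) : Prop :=
  ∀ (n : ℕ) (r : L.Relations n) (v : Fin n → M),
    Structure.RelMap r (g ∘ v) ↔ Structure.RelMap r v

theorem Set.Definable.comp_mem_iff [L.IsRelational] {α : Type*} {S : Set (α → M)}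
    (hS : (∅ : Set M).Definable L S) {g : Equiv.Perm M} (hg : PreservesRelMap L g) (v : α → M) :
    g ∘ v ∈ S ↔ v ∈ S := by
  obtain ⟨φ, rfl⟩ := Set.empty_definable_iff.1 hS
  let e : M ≃[L] M := ⟨g, fun f => isEmptyElim f, fun r v => hg _ r v⟩
  exact StrongHomClass.realize_formula e φ

/-- A relation invariant under all automorphisms is definable. -/
theorem definable_of_invariant [Countable M] (hfin : FinitelyManyDefinable L M) {k : ℕ}
    {S : Set (Fin k → M)}
    (hS : ∀ g : Equiv.Perm M, PreservesRelMap L g → ∀ v ∈ S, g ∘ v ∈ S) :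
    (∅ : Set M).Definable L S := by
  have h : S = ⋃₀ {T | (∅ : Set M).Definable L T ∧ T ⊆ S} := by
    refine Set.Subset.antisymm (fun v hv => ?_) (Set.sUnion_subset fun T hT => hT.2)
    refine ⟨{w | SameType L v w}, ⟨definable_setOf_sameType hfin v, fun w hw => ?_⟩,
      fun _ _ => Iff.rfl⟩
    obtain ⟨e, he, rfl⟩ := SameType.exists_perm hfin hw
    refine hS e (fun n r u => ?_) v hv
    exact (he n u {u | Structure.RelMap r u} (Set.empty_definable_iff.2
      ⟨r.formula Term.var, by ext; simp [Formula.realize_rel]⟩)).symm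
  rw [h]
  exact definable_sUnion_of_finite ((hfin k).subset fun T hT => hT.1) fun T hT => hT.1

end Categoricity

theorem finitelyManyDefinable_rat {L : FirstOrder.Language} [L.IsRelational] [L.Structure ℚ]
    (h : ∀ e : ℚ ≃o ℚ, PreservesRelMap L e.toEquiv) : FinitelyManyDefinable L ℚ := by
  intro k
  let pat : (Fin k → ℚ) → Fin k → Fin k → Prop := fun v i j => v i < v j
  refine Set.Finite.of_finite_image (f := fun S => pat '' S) (Set.toFinite _) ?_
  have key : ∀ S T : Set (Fin k → ℚ), (∅ : Set ℚ).Definable L T → pat '' S = pat '' T →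
      S ⊆ T := by
    intro S T hT hST v hv
    have : pat v ∈ pat '' T := hST ▸ ⟨v, hv, rfl⟩
    obtain ⟨w, hw, hwv⟩ := this
    obtain ⟨e, he⟩ := exists_orderIso_of_lt_iff Finset.univ w v fun i _ j _ =>
      iff_of_eq (congr_fun (congr_fun hwv i) j)
    have : e.toEquiv ∘ w = v := funext fun i => he i (Finset.mem_univ i)
    rw [← this]
    exact (hT.comp_mem_iff (h e) w).2 hw
  exact fun S hS T hT hST => Set.Subset.antisymm (key S T hT hST) (key T S hS hST.symm)

theorem preservesRelMap_iff {n : ℕ} {Q : (Fin n → ℚ) → Prop} {g : Equiv.Perm ℚ} :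
    letI : (relLang n).Structure ℚ := multiRelStructure (fun _ : Unit => Q)
    PreservesRelMap (relLang n) g ↔ g ∈ autRel Q := by
  refine ⟨fun h => h n ⟨(), rfl⟩, fun h m r v => ?_⟩
  obtain ⟨i, rfl⟩ := r
  exact h v

instance isRelational_relLang (n : ℕ) : (relLang n).IsRelational := fun _ =>
  inferInstanceAs (IsEmpty Empty)

theorem definableBy_iff {n k : ℕ} {Q : (Fin n → ℚ) → Prop} {R : (Fin k → ℚ) → Prop}
    (hQ : ContainsOrderAut (autRel Q)) : DefinableBy Q R ↔ autRel Q ≤ autRel R := by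
  let : (relLang n).Structure ℚ := multiRelStructure (fun _ : Unit => Q)
  have hdef : DefinableBy Q R ↔ (∅ : Set ℚ).Definable (relLang n) {v | R v} := by
    rw [Set.empty_definable_iff]
    exact exists_congr fun φ => by simp [Set.ext_iff]
  rw [hdef]
  refine ⟨fun h g hg v => h.comp_mem_iff (preservesRelMap_iff.2 hg) v, fun h => ?_⟩
  exact definable_of_invariant
    (finitelyManyDefinable_rat fun e => preservesRelMap_iff.2 (hQ e))
    fun g hg v hv => (h (preservesRelMap_iff.1 hg) v).2 hv

theorem eqDefinable_iff {k : ℕ} {R : (Fin k → ℚ) → Prop} : EqDefinable R ↔ autRel R = ⊤ := by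
  let : Language.empty.Structure ℚ := Language.emptyStructure
  have hpres : ∀ g : Equiv.Perm ℚ, PreservesRelMap Language.empty g := fun _ _ r => isEmptyElim r
  have hdef : EqDefinable R ↔ (∅ : Set ℚ).Definable Language.empty {v | R v} := by
    rw [Set.empty_definable_iff]
    exact exists_congr fun φ => by simp [Set.ext_iff]
  rw [hdef, Subgroup.eq_top_iff']
  refine ⟨fun h g v => h.comp_mem_iff (hpres g) v, fun h => ?_⟩
  exact definable_of_invariant (finitelyManyDefinable_rat fun e => hpres _)
    fun g _ v hv => (h g v).2 hv

theorem defEquiv_iff {n k : ℕ} {Q : (Fin n → ℚ) → Prop} {R : (Fin k → ℚ) → Prop}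
    (hQ : ContainsOrderAut (autRel Q)) (hR : ContainsOrderAut (autRel R)) :
    DefEquiv Q R ↔ autRel Q = autRel R := by
  rw [DefEquiv, definableBy_iff hQ, definableBy_iff hR, le_antisymm_iff]

theorem containsOrderAut_autRel_ltRel : ContainsOrderAut (autRel ltRel) := fun e =>
  mem_autRel_ltRel.2 e.strictMono

theorem containsOrderAut_autRel_bRel : ContainsOrderAut (autRel bRel) := fun e =>
  mem_autRel_bRel.2 (Or.inl e.strictMono)

theorem containsOrderAut_autRel_cRel : ContainsOrderAut (autRel cRel) := fun e =>
  mem_autRel_cRel.2 e.strictMono.preservesCyc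

/-- Every relation `R` on `ℚ` definable in `⟨ℚ, <⟩` satisfies exactly one of:
`R ≈ <`, `R ≈ b`, `R ≈ c`, `R ≈ s`, or `R` is definable in the pure language of
equality. -/
theorem classification_of_definable_relations {n : ℕ} (R : (Fin n → ℚ) → Prop)
    (hR : DefinableBy ltRel R) :
    (DefEquiv R ltRel ∧ ¬ DefEquiv R bRel ∧ ¬ DefEquiv R cRel ∧ ¬ DefEquiv R sRel ∧
        ¬ EqDefinable R) ∨
    (¬ DefEquiv R ltRel ∧ DefEquiv R bRel ∧ ¬ DefEquiv R cRel ∧ ¬ DefEquiv R sRel ∧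
        ¬ EqDefinable R) ∨
    (¬ DefEquiv R ltRel ∧ ¬ DefEquiv R bRel ∧ DefEquiv R cRel ∧ ¬ DefEquiv R sRel ∧
        ¬ EqDefinable R) ∨
    (¬ DefEquiv R ltRel ∧ ¬ DefEquiv R bRel ∧ ¬ DefEquiv R cRel ∧ DefEquiv R sRel ∧
        ¬ EqDefinable R) ∨
    (¬ DefEquiv R ltRel ∧ ¬ DefEquiv R bRel ∧ ¬ DefEquiv R cRel ∧ ¬ DefEquiv R sRel ∧
        EqDefinable R) := by
  have hRG : ContainsOrderAut (autRel R) := fun e =>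
    (definableBy_iff containsOrderAut_autRel_ltRel).1 hR (containsOrderAut_autRel_ltRel e)
  rw [defEquiv_iff hRG containsOrderAut_autRel_ltRel, defEquiv_iff hRG containsOrderAut_autRel_bRel,
    defEquiv_iff hRG containsOrderAut_autRel_cRel, defEquiv_iff hRG containsOrderAut_autRel_sRel,
    eqDefinable_iff]
  obtain ⟨h1, h2, h3, h4, h5, h6, h7, h8, h9, h10⟩ := pairwise_ne_autRel
  rcases eq_autRel_or_top hRG (isFinitelyClosed_autRel R) with h | h | h | h | h <;>
    simp only [h] <;> grind
end

section
/- Suppose a₁,…,aₙ, b₁,…,bₙ ∈ ℤ × ℕ are such that aᵢ − aⱼ = bᵢ − bⱼ (as elements of ℤ ∪ {∞}) for all i,j ≤ n. Then the partial mapping aᵢ ↦ bᵢ can be extended to a shift, i.e. there is a bijection f of ℤ × ℕ with f(a) − f(b) = a − b for all a, b and f(aᵢ) = bᵢ for all i ≤ n. -/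
/-- The difference `a − b` of elements of `ℤ × ℕ` (the support of `M_Z`), an element of
`ℤ ∪ {∞}`: it is `a¹ − b¹` if the two elements are in the same galaxy, `∞` otherwise. -/
def diff (a b : ℤ × ℕ) : WithTop ℤ := if a.2 = b.2 then ((a.1 - b.1 : ℤ) : WithTop ℤ) else ⊤

theorem diff_eq_diff_iff (a b c d : ℤ × ℕ) :
    diff a b = diff c d ↔
      (a.2 = b.2 ↔ c.2 = d.2) ∧ (a.2 = b.2 → a.1 - b.1 = c.1 - d.1) := by
  unfold diff
  by_cases hab : a.2 = b.2 <;> by_cases hcd : c.2 = d.2 <;>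
    simp [hab, hcd, -WithTop.LinearOrderedAddCommGroup.coe_sub]

/-- The permutation of `ℤ × ℕ` that permutes the galaxies by `σ` and translates the galaxy `s`
by `t s`. -/
def galaxyShift (σ : Equiv.Perm ℕ) (t : ℕ → ℤ) : Equiv.Perm (ℤ × ℕ) where
  toFun x := (x.1 + t x.2, σ x.2)
  invFun y := (y.1 - t (σ.symm y.2), σ.symm y.2)
  left_inv x := by simp
  right_inv y := by simp

theorem diff_galaxyShift (σ : Equiv.Perm ℕ) (t : ℕ → ℤ) (x y : ℤ × ℕ) :
    diff (galaxyShift σ t x) (galaxyShift σ t y) = diff x y := by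
  rw [diff_eq_diff_iff]
  refine ⟨σ.injective.eq_iff, fun hxy => ?_⟩
  have h : x.2 = y.2 := σ.injective hxy
  simp [galaxyShift, h]

/-- If `aᵢ − aⱼ = bᵢ − bⱼ` always holds, some permutation of the galaxies
carries that of `aᵢ` to that of `bᵢ`. -/
theorem exists_perm_galaxies {ι : Type*} [Finite ι] (a b : ι → ℤ × ℕ)
    (h : ∀ i j, diff (a i) (a j) = diff (b i) (b j)) :
    ∃ σ : Equiv.Perm ℕ, ∀ i, σ (a i).2 = (b i).2 := by
  have hab i j : (a i).2 = (a j).2 ↔ (b i).2 = (b j).2 := ((diff_eq_diff_iff _ _ _ _).1 (h i j)).1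
  choose c hc using fun s : Set.range fun i => (a i).2 => s.2
  obtain ⟨σ, hσ⟩ := Equiv.Perm.exists_extending_pair
    (fun s : Set.range fun i => (a i).2 => (s : ℕ)) (fun s => (b (c s)).2)
    Subtype.val_injective
    (fun s t hst => Subtype.ext ((hc s).symm.trans (((hab _ _).2 hst).trans (hc t))))
  exact ⟨σ, fun i => (hσ ⟨_, i, rfl⟩).trans ((hab _ _).1 (hc ⟨_, i, rfl⟩))⟩

/-- If `aᵢ − aⱼ = bᵢ − bⱼ` always holds, the displacement `bᵢ¹ − aᵢ¹` depends only on the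
galaxy of `aᵢ`. -/
theorem exists_galaxy_translation {ι : Type*} (a b : ι → ℤ × ℕ)
    (h : ∀ i j, diff (a i) (a j) = diff (b i) (b j)) :
    ∃ t : ℕ → ℤ, ∀ i, t (a i).2 = (b i).1 - (a i).1 := by
  have hfac : Function.FactorsThrough (fun i => (b i).1 - (a i).1) (fun i => (a i).2) := by
    intro i j hij
    have := ((diff_eq_diff_iff _ _ _ _).1 (h i j)).2 hij
    dsimp only
    lia
  exact ⟨Function.extend (fun i => (a i).2) (fun i => (b i).1 - (a i).1) 0,
    fun i => hfac.extend_apply 0 i⟩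

/-- If `a₁, …, aₙ, b₁, …, bₙ ∈ ℤ × ℕ` satisfy `aᵢ − aⱼ = bᵢ − bⱼ` for all `i, j ≤ n`, then
the partial mapping `aᵢ ↦ bᵢ` extends to a shift, i.e. a bijection `f` of `ℤ × ℕ` with
`f(a) − f(b) = a − b` for all `a, b`. -/
theorem extend_to_shift_MZ {n : ℕ} (a b : Fin n → ℤ × ℕ)
    (h : ∀ i j : Fin n, diff (a i) (a j) = diff (b i) (b j)) :
    ∃ f : Equiv.Perm (ℤ × ℕ), (∀ x y : ℤ × ℕ, diff (f x) (f y) = diff x y) ∧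
      ∀ i : Fin n, f (a i) = b i := by
  obtain ⟨σ, hσ⟩ := exists_perm_galaxies a b h
  obtain ⟨t, ht⟩ := exists_galaxy_translation a b h
  refine ⟨galaxyShift σ t, diff_galaxyShift σ t, fun i => Prod.ext ?_ (hσ i)⟩
  simp [galaxyShift, ht]
end

section
/- Let Γ' be a group of permutations of ℤ × ℕ containing all shifts. Then (i) if z₁ and z₂ are integers regular with respect to Γ', then z₁ + z₂ and z₁ − z₂ are regular with respect to Γ'; and (ii) the greatest common divisor of two integers regular with respect to Γ' is regular with respect to Γ'. -/
/-- A shift: a bijection of `ℤ × ℕ` preserving all differences. -/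
def IsShift (f : Equiv.Perm (ℤ × ℕ)) : Prop := ∀ a b : ℤ × ℕ, diff (f a) (f b) = diff a b

/-- The set `K_z = {γ(a) − γ(b) : γ ∈ G, a − b = z}` for a set `G` of permutations. -/
def KSet (G : Set (Equiv.Perm (ℤ × ℕ))) (z : WithTop ℤ) : Set (WithTop ℤ) :=
  {w | ∃ γ ∈ G, ∃ a b : ℤ × ℕ, diff a b = z ∧ diff (γ a) (γ b) = w}

/-- An integer `z` is regular with respect to `G` if `K_z` is finite and `∞ ∉ K_z`. -/
def Regular (G : Set (Equiv.Perm (ℤ × ℕ))) (z : ℤ) : Prop :=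
  (KSet G ((z : ℤ) : WithTop ℤ)).Finite ∧ ⊤ ∉ KSet G ((z : ℤ) : WithTop ℤ)

theorem diff_eq_coe_iff {a b : ℤ × ℕ} {z : ℤ} :
    diff a b = (z : WithTop ℤ) ↔ a.2 = b.2 ∧ a.1 = b.1 + z := by
  unfold diff
  split_ifs with h
  · rw [WithTop.coe_eq_coe]
    grind
  · simp [h]

/-- Regularity says that the differences in question all lie in one finite set of integers. -/
theorem regular_iff {G : Set (Equiv.Perm (ℤ × ℕ))} {z : ℤ} :
    Regular G z ↔ ∃ S : Set ℤ, S.Finite ∧ ∀ γ ∈ G, ∀ a b : ℤ × ℕ,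
      diff a b = (z : WithTop ℤ) → ∃ s ∈ S, diff (γ a) (γ b) = (s : WithTop ℤ) := by
  constructor
  · rintro ⟨hfin, htop⟩
    refine ⟨(fun s : ℤ => (s : WithTop ℤ)) ⁻¹' KSet G z,
      hfin.preimage WithTop.coe_injective.injOn, fun γ hγ a b hab => ?_⟩
    have hmem : diff (γ a) (γ b) ∈ KSet G z := ⟨γ, hγ, a, b, hab, rfl⟩
    obtain ⟨s, hs⟩ := WithTop.ne_top_iff_exists.mp (ne_of_mem_of_not_mem hmem htop)
    exact ⟨s, by simpa [hs] using hmem, hs.symm⟩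
  · rintro ⟨S, hS, h⟩
    refine ⟨(hS.image fun s : ℤ => (s : WithTop ℤ)).subset ?_, ?_⟩
    · rintro w ⟨γ, hγ, a, b, hab, rfl⟩
      obtain ⟨s, hs, hw⟩ := h γ hγ a b hab
      exact ⟨s, hs, hw.symm⟩
    · rintro ⟨γ, hγ, a, b, hab, hw⟩
      obtain ⟨s, -, hs⟩ := h γ hγ a b hab
      exact WithTop.coe_ne_top (hs.symm.trans hw)

theorem Regular.zero (G : Set (Equiv.Perm (ℤ × ℕ))) : Regular G 0 := by
  refine regular_iff.mpr ⟨{0}, Set.finite_singleton 0, fun γ _ a b hab => ⟨0, rfl, ?_⟩⟩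
  obtain ⟨h2, h1⟩ := diff_eq_coe_iff.mp hab
  obtain rfl : a = b := Prod.ext (by simpa using h1) h2
  simp [diff]

theorem Regular.neg {G : Set (Equiv.Perm (ℤ × ℕ))} {z : ℤ} (h : Regular G z) :
    Regular G (-z) := by
  obtain ⟨S, hS, h⟩ := regular_iff.mp h
  refine regular_iff.mpr ⟨Neg.neg '' S, hS.image _, fun γ hγ a b hab => ?_⟩
  rw [diff_eq_coe_iff] at hab
  obtain ⟨s, hs, hd⟩ := h γ hγ b a (diff_eq_coe_iff.mpr ⟨hab.1.symm, by omega⟩)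
  rw [diff_eq_coe_iff] at hd
  exact ⟨-s, ⟨s, hs, rfl⟩, diff_eq_coe_iff.mpr ⟨hd.1.symm, by omega⟩⟩

theorem Regular.add {G : Set (Equiv.Perm (ℤ × ℕ))} {z₁ z₂ : ℤ} (h₁ : Regular G z₁)
    (h₂ : Regular G z₂) : Regular G (z₁ + z₂) := by
  obtain ⟨S, hS, h₁⟩ := regular_iff.mp h₁
  obtain ⟨T, hT, h₂⟩ := regular_iff.mp h₂
  refine regular_iff.mpr ⟨Set.image2 (· + ·) S T, hS.image2 _ hT, fun γ hγ a b hab => ?_⟩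
  rw [diff_eq_coe_iff] at hab
  obtain ⟨s, hs, hds⟩ := h₁ γ hγ a (b.1 + z₂, b.2)
    (diff_eq_coe_iff.mpr ⟨hab.1, by simp only; omega⟩)
  obtain ⟨t, ht, hdt⟩ := h₂ γ hγ (b.1 + z₂, b.2) b (diff_eq_coe_iff.mpr ⟨rfl, rfl⟩)
  rw [diff_eq_coe_iff] at hds hdt
  exact ⟨s + t, ⟨s, hs, t, ht, rfl⟩,
    diff_eq_coe_iff.mpr ⟨hds.1.trans hdt.1, by omega⟩⟩

/-- The integers regular with respect to `G`, as an additive subgroup of `ℤ`. -/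
def regularAddSubgroup (G : Set (Equiv.Perm (ℤ × ℕ))) : AddSubgroup ℤ where
  carrier := {z | Regular G z}
  zero_mem' := Regular.zero G
  add_mem' := Regular.add
  neg_mem' := Regular.neg

/-- Let `Γ'` be a group of permutations of `ℤ × ℕ` containing all shifts.  If `z₁, z₂` are
regular with respect to `Γ'`, then so are `z₁ + z₂`, `z₁ − z₂`, and `gcd(z₁, z₂)`. -/
theorem regular_closed (Γ' : Subgroup (Equiv.Perm (ℤ × ℕ)))
    (hΓ : ∀ f : Equiv.Perm (ℤ × ℕ), IsShift f → f ∈ Γ')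
    (z₁ z₂ : ℤ) (h₁ : Regular (Γ' : Set (Equiv.Perm (ℤ × ℕ))) z₁)
    (h₂ : Regular (Γ' : Set (Equiv.Perm (ℤ × ℕ))) z₂) :
    Regular (Γ' : Set (Equiv.Perm (ℤ × ℕ))) (z₁ + z₂) ∧
    Regular (Γ' : Set (Equiv.Perm (ℤ × ℕ))) (z₁ - z₂) ∧
    Regular (Γ' : Set (Equiv.Perm (ℤ × ℕ))) (Int.gcd z₁ z₂ : ℤ) := by
  refine ⟨h₁.add h₂, by simpa only [sub_eq_add_neg] using h₁.add h₂.neg, ?_⟩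
  change _ ∈ regularAddSubgroup (Γ' : Set (Equiv.Perm (ℤ × ℕ)))
  rw [Int.gcd_eq_gcd_ab, mul_comm z₁, mul_comm z₂]
  exact add_mem (zsmul_mem (x := z₁) h₁ _) (zsmul_mem (x := z₂) h₂ _)
end
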